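/- arXiv:2111.14187 — 3 statements merged into one kernel-verified Lean document; each statement's English description precedes it below -/
import Mathlib

section
/- Under the hypotheses: (X_n) is a Markov chain on Ω, f : Ω → [0,∞) measurable, K = {f ≤ R₀}, increments from K are stochastically dominated by an integrable Z₀ and increments from Ω∖K by an integrable Z₁ with E[Z₁] = −λ₁ < 0 (condition (SD)), then for every ε > 0 there exists R > 0 such that for every x ∈ Ω and every n ≥ 1, P_x(f(X_n) > R) < ε + f(x)/(nλ₁). -/
open MeasureTheory Set Filter
open scoped ENNReal

/-- Markov chain family: see the paper, Section 2. -/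
def IsMarkovChainFamily {Ω : Type*} [MeasurableSpace Ω] (P : Ω → Measure (ℕ → Ω)) : Prop :=
  (∀ x, IsProbabilityMeasure (P x)) ∧
  (∀ x, P x {ω | ω 0 = x} = 1) ∧
  (∀ (x : Ω) (n : ℕ) (B : Set (ℕ → Ω)), MeasurableSet B →
    ∀ C : Set (ℕ → Ω), MeasurableSet C →
      (∀ ω ω' : ℕ → Ω, (∀ k ≤ n, ω k = ω' k) → (ω ∈ C ↔ ω' ∈ C)) →
      P x (C ∩ {ω | (fun k => ω (n + k)) ∈ B}) = ∫⁻ ω in C, P (ω n) B ∂ P x)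

/-- An upper set of reals is, up to an endpoint, an open ray, so comparing the masses of open rays
suffices to compare the masses of all upper sets. -/
lemma measure_le_of_isUpperSet {μ ν : Measure ℝ} [IsProbabilityMeasure μ] [IsProbabilityMeasure ν]
    (h : ∀ t, μ (Ioi t) ≤ ν (Ioi t)) {U : Set ℝ} (hU : IsUpperSet U) : μ U ≤ ν U := by
  rcases U.eq_empty_or_nonempty with rfl | hne
  · simp
  by_cases hb : BddBelow U
  · have hsub : Ioi (sInf U) ⊆ U := by
      intro y hy
      obtain ⟨z, hz, hzy⟩ := exists_lt_of_csInf_lt hne hy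
      exact hU hzy.le hz
    by_cases ha : sInf U ∈ U
    · have hIci : U = Ici (sInf U) :=
        Subset.antisymm (fun y hy => csInf_le hb hy) (fun y hy => hU hy ha)
      have hlim : Tendsto (fun n : ℕ => ν (Ioi (sInf U - 1 / ((n : ℝ) + 1)))) atTop
          (nhds (ν (⋂ n : ℕ, Ioi (sInf U - 1 / ((n : ℝ) + 1))))) := by
        refine tendsto_measure_iInter_atTop (fun n => measurableSet_Ioi.nullMeasurableSet) ?_
          ⟨0, measure_ne_top _ _⟩
        intro m n hmn
        refine Ioi_subset_Ioi ?_
        have : 1 / ((n : ℝ) + 1) ≤ 1 / ((m : ℝ) + 1) := Nat.one_div_le_one_div hmn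
        linarith
      have hInter : (⋂ n : ℕ, Ioi (sInf U - 1 / ((n : ℝ) + 1))) = Ici (sInf U) := by
        ext y
        simp only [mem_iInter, mem_Ioi, mem_Ici]
        constructor
        · intro hy
          by_contra! hlt
          obtain ⟨n, hn⟩ := exists_nat_one_div_lt (sub_pos.2 hlt)
          have := hy n
          linarith
        · intro hy n
          have : 0 < 1 / ((n : ℝ) + 1) := Nat.one_div_pos_of_nat
          linarith
      rw [hInter] at hlim
      rw [hIci]
      refine ge_of_tendsto' hlim fun n => (measure_mono ?_).trans (h _)
      intro y hy
      have : 0 < 1 / ((n : ℝ) + 1) := Nat.one_div_pos_of_nat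
      simp only [mem_Ici, mem_Ioi] at hy ⊢
      linarith
    · have hIoi : U = Ioi (sInf U) :=
        Subset.antisymm (fun y hy => lt_of_le_of_ne (csInf_le hb hy) (fun e => ha (e ▸ hy))) hsub
      rw [hIoi]
      exact h _
  · have : U = univ := by
      refine eq_univ_of_forall fun y => ?_
      obtain ⟨z, hz, hzy⟩ := not_bddBelow_iff.1 hb y
      exact hU hzy.le hz
    simp [this]

/-- Stochastic domination passes to expectations of monotone real functions. -/
lemma lintegral_ofReal_le_of_stochasticDominance {μ ν : Measure ℝ} [IsProbabilityMeasure μ]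
    [IsProbabilityMeasure ν] (h : ∀ t, μ (Ioi t) ≤ ν (Ioi t)) {g : ℝ → ℝ} (hg : Monotone g)
    (hg0 : ∀ s, 0 ≤ g s) : ∫⁻ s, ENNReal.ofReal (g s) ∂μ ≤ ∫⁻ s, ENNReal.ofReal (g s) ∂ν := by
  rw [lintegral_eq_lintegral_meas_lt μ (ae_of_all _ hg0) hg.measurable.aemeasurable,
    lintegral_eq_lintegral_meas_lt ν (ae_of_all _ hg0) hg.measurable.aemeasurable]
  exact lintegral_mono fun t => measure_le_of_isUpperSet h fun a b hab ha => lt_of_lt_of_le ha (hg hab)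

lemma lintegral_le_of_stochasticDominance {μ ν : Measure ℝ} [IsProbabilityMeasure μ]
    [IsProbabilityMeasure ν] (h : ∀ t, μ (Ioi t) ≤ ν (Ioi t)) {g : ℝ → ℝ≥0∞} (hg : Monotone g)
    (hg1 : ∀ s, g s ≤ 1) : ∫⁻ s, g s ∂μ ≤ ∫⁻ s, g s ∂ν := by
  have hfin : ∀ s, g s ≠ ⊤ := fun s => ne_top_of_le_ne_top ENNReal.one_ne_top (hg1 s)
  have := lintegral_ofReal_le_of_stochasticDominance h (g := fun s => (g s).toReal)
    (fun a b hab => ENNReal.toReal_mono (hfin b) (hg hab)) (fun s => ENNReal.toReal_nonneg)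
  simpa only [ENNReal.ofReal_toReal (hfin _)] using this

/-- Truncating far below preserves the strict negativity of the mean. -/
lemma eventually_lintegral_ofReal_add_le {ζ : Measure ℝ} [IsProbabilityMeasure ζ]
    (hint : Integrable id ζ) {lam l : ℝ} (hmean : ∫ z, z ∂ζ = -lam) (hl0 : 0 ≤ l) (hl : l < lam) :
    ∀ᶠ M : ℝ in atTop,
      ∫⁻ z, ENNReal.ofReal (z + M) ∂ζ + ENNReal.ofReal l ≤ ENNReal.ofReal M := by
  have hlim : Tendsto (fun M : ℝ => ∫ z, max z (-M) ∂ζ) atTop (nhds (∫ z, z ∂ζ)) := by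
    refine tendsto_integral_filter_of_dominated_convergence (fun z => |z|)
      (Eventually.of_forall fun M =>
        (measurable_id.max measurable_const).aestronglyMeasurable) ?_ hint.abs ?_
    · filter_upwards [eventually_ge_atTop 0] with M hM
      refine ae_of_all _ fun z => ?_
      rw [Real.norm_eq_abs]
      refine abs_le.2 ⟨(neg_abs_le z).trans (le_max_left _ _), max_le (le_abs_self z) ?_⟩
      linarith [abs_nonneg z]
    · refine ae_of_all _ fun z => ?_
      refine tendsto_const_nhds.congr' ?_
      filter_upwards [eventually_ge_atTop (-z)] with M hM
      rw [max_eq_left]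
      linarith
  rw [hmean] at hlim
  filter_upwards [hlim.eventually_lt_const (neg_lt_neg hl), eventually_ge_atTop 0] with M hM hM0
  have hmax : Integrable (fun z : ℝ => max z (-M)) ζ := hint.sup (integrable_const (-M))
  have heq : ∀ z : ℝ, ENNReal.ofReal (z + M) = ENNReal.ofReal (max z (-M) + M) := by
    intro z
    rcases le_total z (-M) with h | h
    · rw [max_eq_right h, ENNReal.ofReal_of_nonpos (by linarith)]
      simp
    · rw [max_eq_left h]
  have hnn : ∀ z : ℝ, 0 ≤ max z (-M) + M := fun z => by linarith [le_max_right z (-M)]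
  have hsum : Integrable (fun z : ℝ => max z (-M) + M) ζ := hmax.add (integrable_const M)
  rw [lintegral_congr heq, ← ofReal_integral_eq_lintegral_ofReal hsum (ae_of_all _ hnn),
    ← ENNReal.ofReal_add (integral_nonneg hnn) hl0]
  refine ENNReal.ofReal_le_ofReal ?_
  rw [integral_add hmax (integrable_const M)]
  simp
  linarith

/-- The probability that a random walk with step law `ζ`, started at `s`, stays above `a` before
time `k` and is above `R` at time `k`. -/
noncomputable def walkTail (ζ : Measure ℝ) (a R : ℝ) : ℕ → ℝ → ℝ≥0∞
  | 0 => (Ioi R).indicator 1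
  | k + 1 => (Ioi a).indicator fun s => ∫⁻ z, walkTail ζ a R k (s + z) ∂ζ

lemma monotone_indicator_Ioi {g : ℝ → ℝ≥0∞} (hg : Monotone g) (a : ℝ) :
    Monotone ((Ioi a).indicator g) := by
  intro s t hst
  by_cases hs : s ∈ Ioi a
  · rw [indicator_of_mem hs, indicator_of_mem (mem_Ioi.2 (lt_of_lt_of_le hs hst))]
    exact hg hst
  · rw [indicator_of_notMem hs]
    exact zero_le

lemma monotone_walkTail (ζ : Measure ℝ) (a R : ℝ) (k : ℕ) : Monotone (walkTail ζ a R k) := by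
  induction k with
  | zero => exact monotone_indicator_Ioi monotone_const R
  | succ k ih =>
    exact monotone_indicator_Ioi
      (fun s t hst => lintegral_mono fun z => ih (add_le_add_left hst z)) a

lemma measurable_walkTail_add (ζ : Measure ℝ) (a R : ℝ) (k : ℕ) (s : ℝ) :
    Measurable fun z => walkTail ζ a R k (s + z) :=
  (monotone_walkTail ζ a R k).measurable.comp (measurable_const_add s)

lemma walkTail_le_one (ζ : Measure ℝ) [IsProbabilityMeasure ζ] (a R : ℝ) (k : ℕ) (s : ℝ) :
    walkTail ζ a R k s ≤ 1 := by
  induction k generalizing s with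
  | zero => exact indicator_le_self' (fun _ _ => zero_le) s
  | succ k ih =>
    refine (indicator_le_self' (fun _ _ => zero_le) s).trans ?_
    exact (lintegral_mono fun z => ih (s + z)).trans (by simp)

lemma walkTail_anti (ζ : Measure ℝ) (a : ℝ) {R R' : ℝ} (hR : R ≤ R') (k : ℕ) (s : ℝ) :
    walkTail ζ a R' k s ≤ walkTail ζ a R k s := by
  induction k generalizing s with
  | zero => exact indicator_le_indicator_of_subset (Ioi_subset_Ioi hR) (fun _ => zero_le) s
  | succ k ih => exact indicator_le_indicator (lintegral_mono fun z => ih (s + z))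

lemma tendsto_lintegral_walkTail (ζ ξ : Measure ℝ) [IsProbabilityMeasure ζ]
    [IsProbabilityMeasure ξ] (a : ℝ) (k : ℕ) (s : ℝ)
    (h : ∀ t, Tendsto (fun n : ℕ => walkTail ζ a n k t) atTop (nhds 0)) :
    Tendsto (fun n : ℕ => ∫⁻ z, walkTail ζ a n k (s + z) ∂ξ) atTop (nhds 0) := by
  have := tendsto_lintegral_of_dominated_convergence (μ := ξ) (fun _ => 1)
    (fun n : ℕ => measurable_walkTail_add ζ a n k s)
    (fun n => ae_of_all _ fun z => walkTail_le_one ζ a n k (s + z)) (by simp)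
    (ae_of_all _ fun z => h (s + z))
  simpa using this

lemma tendsto_walkTail (ζ : Measure ℝ) [IsProbabilityMeasure ζ] (a : ℝ) (k : ℕ) (s : ℝ) :
    Tendsto (fun n : ℕ => walkTail ζ a n k s) atTop (nhds 0) := by
  induction k generalizing s with
  | zero =>
    refine tendsto_const_nhds.congr' ?_
    filter_upwards [eventually_ge_atTop ⌈s⌉₊] with n hn
    exact (indicator_of_notMem (not_lt.2 (Nat.ceil_le.1 hn)) _).symm
  | succ k ih =>
    by_cases hs : s ∈ Ioi a
    · simpa only [walkTail, indicator_of_mem hs] using tendsto_lintegral_walkTail ζ ζ a k s ih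
    · simp only [walkTail, indicator_of_notMem hs]
      exact tendsto_const_nhds

/-- The expected time a walk with negative drift spends above `a` before leaving `(a, ∞)` grows at
most linearly in the starting point. -/
lemma mul_sum_walkTail_le {ζ : Measure ℝ} [IsProbabilityMeasure ζ] {a M l : ℝ} (hM0 : 0 ≤ M)
    (hM : ∫⁻ z, ENNReal.ofReal (z + M) ∂ζ + ENNReal.ofReal l ≤ ENNReal.ofReal M) (N : ℕ) (s : ℝ) :
    ENNReal.ofReal l * ∑ k ∈ Finset.range N, walkTail ζ a a k s ≤ ENNReal.ofReal (s - a + M) := by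
  induction N generalizing s with
  | zero => simp
  | succ N ih =>
    by_cases hs : s ∈ Ioi a
    · have hsa : 0 ≤ s - a := sub_nonneg.2 (le_of_lt hs)
      rw [Finset.sum_range_succ']
      simp only [walkTail, indicator_of_mem hs, Pi.one_apply]
      rw [← lintegral_finsetSum _ fun k _ => measurable_walkTail_add ζ a a k s, mul_add, mul_one,
        ← lintegral_const_mul _ (Finset.measurable_fun_sum _ fun k _ =>
          measurable_walkTail_add ζ a a k s)]
      calc _ ≤ ∫⁻ z, (ENNReal.ofReal (s - a) + ENNReal.ofReal (z + M)) ∂ζ + ENNReal.ofReal l := by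
            gcongr with z
            refine (ih (s + z)).trans ?_
            rw [show s + z - a + M = (s - a) + (z + M) by ring]
            exact ENNReal.ofReal_add_le
        _ = ENNReal.ofReal (s - a) + (∫⁻ z, ENNReal.ofReal (z + M) ∂ζ + ENNReal.ofReal l) := by
            rw [lintegral_add_left measurable_const]
            simp [add_assoc]
        _ ≤ ENNReal.ofReal (s - a) + ENNReal.ofReal M := by gcongr
        _ = _ := (ENNReal.ofReal_add hsa hM0).symm
    · have hzero : ∀ k, walkTail ζ a a k s = 0 := by
        intro k
        cases k <;> exact indicator_of_notMem hs _
      simp [hzero]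

lemma tsum_lintegral_walkTail_ne_top {ζ ξ : Measure ℝ} [IsProbabilityMeasure ζ]
    [IsProbabilityMeasure ξ] (hξ : Integrable id ξ) (hint : Integrable id ζ) {lam : ℝ}
    (hlam : 0 < lam) (hmean : ∫ z, z ∂ζ = -lam) (a : ℝ) :
    ∑' k, ∫⁻ z, walkTail ζ a a k (a + z) ∂ξ ≠ ⊤ := by
  obtain ⟨M, hM, hM0⟩ := ((eventually_lintegral_ofReal_add_le hint hmean (half_pos hlam).le
    (half_lt_self hlam)).and (eventually_ge_atTop 0)).exists
  have hl : ENNReal.ofReal (lam / 2) ≠ 0 := by simpa using hlam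
  have hfin : ∫⁻ z, ENNReal.ofReal (z + M) ∂ξ ≠ ⊤ :=
    by
    have hi : Integrable (fun z : ℝ => z + M) ξ := Integrable.add hξ (integrable_const M)
    refine ne_top_of_le_ne_top hi.2.ne (lintegral_mono fun z => ?_)
    exact Real.ofReal_le_enorm _
  refine ne_top_of_le_ne_top (ENNReal.div_ne_top hfin hl) (ENNReal.tsum_le_of_sum_range_le ?_)
  intro N
  rw [ENNReal.le_div_iff_mul_le (Or.inl hl) (Or.inl ENNReal.ofReal_ne_top), mul_comm,
    ← lintegral_finsetSum _ fun k _ => measurable_walkTail_add ζ a a k a,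
    ← lintegral_const_mul _ (Finset.measurable_fun_sum _ fun k _ =>
      measurable_walkTail_add ζ a a k a)]
  refine lintegral_mono fun z => ?_
  simpa using mul_sum_walkTail_le (a := a) hM0 hM N (a + z)

lemma tendsto_tsum_lintegral_walkTail {ζ ξ : Measure ℝ} [IsProbabilityMeasure ζ]
    [IsProbabilityMeasure ξ] (hξ : Integrable id ξ) (hint : Integrable id ζ) {lam : ℝ}
    (hlam : 0 < lam) (hmean : ∫ z, z ∂ζ = -lam) (a : ℝ) :
    Tendsto (fun n : ℕ => ∑' k, ∫⁻ z, walkTail ζ a n k (a + z) ∂ξ) atTop (nhds 0) := by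
  have := tendsto_lintegral_filter_of_dominated_convergence (μ := Measure.count) (l := atTop)
    (F := fun (n k : ℕ) => ∫⁻ z, walkTail ζ a n k (a + z) ∂ξ) (f := fun _ => 0)
    (fun k => ∫⁻ z, walkTail ζ a a k (a + z) ∂ξ)
    (Eventually.of_forall fun n => measurable_from_top)
    (by
      filter_upwards [eventually_ge_atTop ⌈a⌉₊] with n hn
      exact ae_of_all _ fun k =>
        lintegral_mono fun z => walkTail_anti ζ a (Nat.ceil_le.1 hn) k (a + z))
    (by
      rw [lintegral_count]
      exact tsum_lintegral_walkTail_ne_top hξ hint hlam hmean a)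
    (ae_of_all _ fun k => tendsto_lintegral_walkTail ζ ξ a k a (tendsto_walkTail ζ a k))
  simpa [lintegral_count] using this

/-- Paths staying above level `a` before time `n`. -/
def aboveBefore {Ω : Type*} (f : Ω → ℝ) (a : ℝ) (n : ℕ) : Set (ℕ → Ω) :=
  {ω | ∀ j < n, a < f (ω j)}

/-- Paths staying above level `a` before time `n` and above `R` at time `n`. -/
def aboveBeforeAt {Ω : Type*} (f : Ω → ℝ) (a R : ℝ) (n : ℕ) : Set (ℕ → Ω) :=
  aboveBefore f a n ∩ {ω | R < f (ω n)}

lemma aboveBefore_succ {Ω : Type*} (f : Ω → ℝ) (a : ℝ) (n : ℕ) :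
    aboveBefore f a (n + 1) =
      {ω | a < f (ω 0)} ∩ {ω | (fun k => ω (1 + k)) ∈ aboveBefore f a n} := by
  ext ω
  simp only [aboveBefore, mem_ofPred_eq, mem_inter_iff]
  constructor
  · exact fun h => ⟨h 0 (by omega), fun j hj => h (1 + j) (by omega)⟩
  · rintro ⟨h0, h⟩ (_ | j) hj
    · exact h0
    · simpa [add_comm] using h j (by omega)

lemma aboveBeforeAt_succ {Ω : Type*} (f : Ω → ℝ) (a R : ℝ) (n : ℕ) :
    aboveBeforeAt f a R (n + 1) =
      {ω | a < f (ω 0)} ∩ {ω | (fun k => ω (1 + k)) ∈ aboveBeforeAt f a R n} := by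
  ext ω
  rw [aboveBeforeAt, aboveBefore_succ]
  simp only [aboveBeforeAt, mem_ofPred_eq, mem_inter_iff, and_assoc, add_comm n 1]

/-- Last-exit decomposition with respect to `{f ≤ a}`. -/
lemma setOf_lt_subset_last_exit {Ω : Type*} (f : Ω → ℝ) (a R : ℝ) (n : ℕ) :
    {ω : ℕ → Ω | R < f (ω n)} ⊆ aboveBefore f a n ∪ ⋃ j ∈ Finset.range n,
      ({ω | f (ω j) ≤ a} ∩
        {ω | (fun i => ω (j + (1 + i))) ∈ aboveBeforeAt f a R (n - 1 - j)}) := by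
  classical
  intro ω hω
  by_cases hab : ω ∈ aboveBefore f a n
  · exact Or.inl hab
  refine Or.inr ?_
  simp only [aboveBefore, mem_ofPred_eq, not_forall, not_lt] at hab
  obtain ⟨i, hi, hia⟩ := hab
  set S := (Finset.range n).filter fun j => f (ω j) ≤ a with hS
  have hne : S.Nonempty := ⟨i, by simp [hS, hi, hia]⟩
  have hmem := S.max'_mem hne
  set j := S.max' hne with hj
  rw [hS, Finset.mem_filter, Finset.mem_range] at hmem
  refine mem_biUnion (x := j) (by simpa using hmem.1) ⟨hmem.2, ?_, ?_⟩
  · intro m hm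
    by_contra! hle
    have : j + (1 + m) ∈ S := by
      rw [hS, Finset.mem_filter, Finset.mem_range]
      exact ⟨by omega, hle⟩
    have := S.le_max' _ this
    omega
  · have : j + (1 + (n - 1 - j)) = n := by omega
    simpa [this] using hω

section Chain

variable {Ω : Type*} [MeasurableSpace Ω] {P : Ω → Measure (ℕ → Ω)} {f : Ω → ℝ}

lemma measurable_eval_path (hf : Measurable f) (n : ℕ) : Measurable fun ω : ℕ → Ω => f (ω n) :=
  hf.comp (measurable_pi_apply n)

lemma measurable_shift (n : ℕ) : Measurable fun (ω : ℕ → Ω) k => ω (n + k) :=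
  measurable_pi_lambda _ fun k => measurable_pi_apply (n + k)

lemma measurableSet_aboveBefore (hf : Measurable f) (a : ℝ) (n : ℕ) :
    MeasurableSet (aboveBefore f a n) := by
  have : aboveBefore f a n = ⋂ j, ⋂ (_ : j < n), {ω | a < f (ω j)} := by
    ext ω
    simp [aboveBefore]
  rw [this]
  exact MeasurableSet.iInter fun j => MeasurableSet.iInter fun _ =>
    measurableSet_lt measurable_const (measurable_eval_path hf j)

lemma measurableSet_aboveBeforeAt (hf : Measurable f) (a R : ℝ) (n : ℕ) :
    MeasurableSet (aboveBeforeAt f a R n) :=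
  (measurableSet_aboveBefore hf a n).inter
    (measurableSet_lt measurable_const (measurable_eval_path hf n))

lemma ae_start_eq (hP : IsMarkovChainFamily P) (hf : Measurable f) (x : Ω) :
    ∀ᵐ ω ∂P x, f (ω 0) = f x := by
  have := hP.1 x
  have hm : MeasurableSet {ω : ℕ → Ω | f (ω 0) = f x} :=
    measurableSet_eq_fun (measurable_eval_path hf 0) measurable_const
  refine mem_ae_iff.2 ((prob_compl_eq_zero_iff hm).2 (le_antisymm prob_le_one ?_))
  rw [← hP.2.1 x]
  refine measure_mono fun ω hω => ?_
  simp only [mem_ofPred_eq] at hω ⊢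
  rw [hω]

/-- One-step Markov property as an inequality, for chains started above the level `a`. -/
lemma measure_start_inter_shift_le (hP : IsMarkovChainFamily P) (hf : Measurable f) (a : ℝ)
    {B : Set (ℕ → Ω)} (hB : MeasurableSet B) (x : Ω) :
    P x ({ω | a < f (ω 0)} ∩ {ω | (fun k => ω (1 + k)) ∈ B}) ≤ ∫⁻ ω, P (ω 1) B ∂P x := by
  rw [hP.2.2 x 1 B hB _ (measurableSet_lt measurable_const (measurable_eval_path hf 0))
    fun ω ω' h => by simp [h 0 (by omega)]]
  exact setLIntegral_le_lintegral _ _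

lemma measure_start_inter_eq_zero (hP : IsMarkovChainFamily P) (hf : Measurable f) {a : ℝ} {x : Ω}
    (hx : f x ≤ a) (B : Set (ℕ → Ω)) : P x ({ω | a < f (ω 0)} ∩ B) = 0 := by
  refine measure_mono_null inter_subset_left (measure_eq_zero_iff_ae_notMem.2 ?_)
  filter_upwards [ae_start_eq hP hf x] with ω hω
  simpa [hω] using hx

/-- The law of the first increment of `f` along the chain started at `x`. -/
noncomputable def incrementLaw (P : Ω → Measure (ℕ → Ω)) (f : Ω → ℝ) (x : Ω) : Measure ℝ :=
  (P x).map fun ω => f (ω 1) - f x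

lemma measurable_increment (hf : Measurable f) (x : Ω) :
    Measurable fun ω : ℕ → Ω => f (ω 1) - f x :=
  (measurable_eval_path hf 1).sub_const _

lemma isProbabilityMeasure_incrementLaw (hP : IsMarkovChainFamily P) (hf : Measurable f) (x : Ω) :
    IsProbabilityMeasure (incrementLaw P f x) :=
  have := hP.1 x
  Measure.isProbabilityMeasure_map (measurable_increment hf x).aemeasurable

lemma incrementLaw_Ioi_le (hf : Measurable f) {x : Ω} {ζ : Measure ℝ}
    (hdom : ∀ t : ℝ, P x {ω | t < f (ω 1) - f x} ≤ ζ (Ioi t)) (t : ℝ) :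
    incrementLaw P f x (Ioi t) ≤ ζ (Ioi t) := by
  rw [incrementLaw, Measure.map_apply (measurable_increment hf x) measurableSet_Ioi]
  exact hdom t

lemma lintegral_monotone_step_le (hP : IsMarkovChainFamily P) (hf : Measurable f) {x : Ω}
    {ζ : Measure ℝ} [IsProbabilityMeasure ζ]
    (hdom : ∀ t : ℝ, P x {ω | t < f (ω 1) - f x} ≤ ζ (Ioi t)) {g : ℝ → ℝ≥0∞} (hg : Monotone g)
    (hg1 : ∀ s, g s ≤ 1) : ∫⁻ ω, g (f (ω 1)) ∂P x ≤ ∫⁻ z, g (f x + z) ∂ζ := by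
  have := isProbabilityMeasure_incrementLaw hP hf x
  have hmono : Monotone fun z => g (f x + z) := fun s t hst => hg (add_le_add_right hst _)
  refine le_trans (le_of_eq ?_) (lintegral_le_of_stochasticDominance
    (incrementLaw_Ioi_le hf hdom) hmono fun s => hg1 _)
  rw [incrementLaw, lintegral_map hmono.measurable (measurable_increment hf x)]
  simp

lemma lintegral_step_add_drift_le (hP : IsMarkovChainFamily P) (hf : Measurable f)
    (hf0 : ∀ x, 0 ≤ f x) {x : Ω} {ζ : Measure ℝ} [IsProbabilityMeasure ζ]
    (hint : Integrable id ζ) {lam : ℝ} (hlam : 0 < lam) (hmean : ∫ z, z ∂ζ = -lam)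
    (hdom : ∀ t : ℝ, P x {ω | t < f (ω 1) - f x} ≤ ζ (Ioi t)) :
    ∫⁻ ω, ENNReal.ofReal (f (ω 1)) ∂P x + ENNReal.ofReal lam ≤ ENNReal.ofReal (f x) := by
  have := hP.1 x
  have := isProbabilityMeasure_incrementLaw hP hf x
  have key : ∀ l, 0 < l → l < lam →
      ∫⁻ ω, ENNReal.ofReal (f (ω 1)) ∂P x + ENNReal.ofReal l ≤ ENNReal.ofReal (f x) := by
    intro l hl0 hl
    obtain ⟨M, hM, hMx⟩ := ((eventually_lintegral_ofReal_add_le hint hmean hl0.le hl).and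
      (eventually_ge_atTop (f x))).exists
    have hmono : Monotone fun z : ℝ => max (z + M) 0 :=
      fun s t hst => max_le_max_right 0 (add_le_add_left hst M)
    have hle := lintegral_ofReal_le_of_stochasticDominance (incrementLaw_Ioi_le hf hdom) hmono
      fun s => le_max_right _ _
    rw [incrementLaw, lintegral_map (f := fun s => ENNReal.ofReal (max (s + M) 0))
      (ENNReal.measurable_ofReal.comp hmono.measurable) (measurable_increment hf x)] at hle
    simp only [ENNReal.ofReal_max, ENNReal.ofReal_zero, max_eq_left zero_le] at hle
    have hsplit : ∀ ω : ℕ → Ω, ENNReal.ofReal (f (ω 1) - f x + M) =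
        ENNReal.ofReal (f (ω 1)) + ENNReal.ofReal (M - f x) := fun ω => by
      rw [← ENNReal.ofReal_add (hf0 _) (sub_nonneg.2 hMx)]
      ring_nf
    simp only [hsplit] at hle
    rw [lintegral_add_right _ measurable_const, lintegral_const, measure_univ, mul_one] at hle
    refine (ENNReal.add_le_add_iff_right (ENNReal.ofReal_ne_top (r := M - f x))).1 ?_
    rw [← ENNReal.ofReal_add (hf0 x) (sub_nonneg.2 hMx), add_right_comm,
      add_sub_cancel]
    exact (add_le_add_left hle _).trans hM
  have hlim : Tendsto (fun l => ∫⁻ ω, ENNReal.ofReal (f (ω 1)) ∂P x + ENNReal.ofReal l)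
      (nhdsWithin lam (Iio lam))
      (nhds (∫⁻ ω, ENNReal.ofReal (f (ω 1)) ∂P x + ENNReal.ofReal lam)) :=
    tendsto_const_nhds.add
      ((ENNReal.continuous_ofReal.tendsto lam).mono_left nhdsWithin_le_nhds)
  refine le_of_tendsto hlim ?_
  filter_upwards [Ioo_mem_nhdsLT hlam] with l hl
  exact key l hl.1 hl.2

lemma measure_aboveBefore_mul_le (hP : IsMarkovChainFamily P) (hf : Measurable f)
    (hf0 : ∀ x, 0 ≤ f x) {a : ℝ} {ζ : Measure ℝ} [IsProbabilityMeasure ζ]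
    (hint : Integrable id ζ) {lam : ℝ} (hlam : 0 < lam) (hmean : ∫ z, z ∂ζ = -lam)
    (hdom : ∀ x, a < f x → ∀ t : ℝ, P x {ω | t < f (ω 1) - f x} ≤ ζ (Ioi t)) (n : ℕ) (x : Ω) :
    P x (aboveBefore f a n) * ENNReal.ofReal (n * lam) ≤ ENNReal.ofReal (f x) := by
  induction n generalizing x with
  | zero => simp
  | succ n ih =>
    have := hP.1 x
    rcases le_or_gt (f x) a with hx | hx
    · rw [aboveBefore_succ, measure_start_inter_eq_zero hP hf hx]
      simp
    have hn : (0 : ℝ) ≤ n * lam := by positivity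
    have hsucc : ((n + 1 : ℕ) : ℝ) * lam = n * lam + lam := by push_cast; ring
    rw [hsucc, ENNReal.ofReal_add hn hlam.le, mul_add]
    refine le_trans (add_le_add ?_ ?_)
      (lintegral_step_add_drift_le hP hf hf0 hint hlam hmean (hdom x hx))
    · rw [aboveBefore_succ]
      calc _ ≤ (∫⁻ ω, P (ω 1) (aboveBefore f a n) ∂P x) * ENNReal.ofReal (n * lam) := by
            gcongr
            exact measure_start_inter_shift_le hP hf a (measurableSet_aboveBefore hf a n) x
        _ ≤ ∫⁻ ω, P (ω 1) (aboveBefore f a n) * ENNReal.ofReal (n * lam) ∂P x :=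
            lintegral_mul_const_le _ _
        _ ≤ _ := lintegral_mono fun ω => ih (ω 1)
    · exact mul_le_of_le_one_left zero_le prob_le_one

lemma measure_aboveBeforeAt_le (hP : IsMarkovChainFamily P) (hf : Measurable f) {a : ℝ}
    {ζ : Measure ℝ} [IsProbabilityMeasure ζ]
    (hdom : ∀ x, a < f x → ∀ t : ℝ, P x {ω | t < f (ω 1) - f x} ≤ ζ (Ioi t)) (R : ℝ) (k : ℕ)
    (x : Ω) : P x (aboveBeforeAt f a R k) ≤ walkTail ζ a R k (f x) := by
  induction k generalizing x with
  | zero =>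
    have := hP.1 x
    have hset : aboveBeforeAt f a R 0 = {ω | R < f (ω 0)} ∩ univ := by
      ext ω
      simp [aboveBeforeAt, aboveBefore]
    rcases le_or_gt (f x) R with hx | hx
    · rw [hset, measure_start_inter_eq_zero hP hf hx]
      exact zero_le
    · simp only [walkTail, indicator_of_mem (mem_Ioi.2 hx), Pi.one_apply]
      exact prob_le_one
  | succ k ih =>
    rw [aboveBeforeAt_succ]
    rcases le_or_gt (f x) a with hx | hx
    · rw [measure_start_inter_eq_zero hP hf hx]
      exact zero_le
    · simp only [walkTail, indicator_of_mem (mem_Ioi.2 hx)]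
      calc _ ≤ ∫⁻ ω, P (ω 1) (aboveBeforeAt f a R k) ∂P x :=
            measure_start_inter_shift_le hP hf a (measurableSet_aboveBeforeAt hf a R k) x
        _ ≤ ∫⁻ ω, walkTail ζ a R k (f (ω 1)) ∂P x := lintegral_mono fun ω => ih (ω 1)
        _ ≤ _ := lintegral_monotone_step_le hP hf (hdom x hx) (monotone_walkTail ζ a R k)
            (walkTail_le_one ζ a R k)

/-- Paths visiting `{f ≤ a}` at time `j` and following an excursion above `a` afterwards. -/
lemma measure_excursion_le (hP : IsMarkovChainFamily P) (hf : Measurable f) {a : ℝ}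
    {ξ ζ : Measure ℝ} [IsProbabilityMeasure ξ] [IsProbabilityMeasure ζ]
    (hdom0 : ∀ x, f x ≤ a → ∀ t : ℝ, P x {ω | t < f (ω 1) - f x} ≤ ξ (Ioi t))
    (hdom1 : ∀ x, a < f x → ∀ t : ℝ, P x {ω | t < f (ω 1) - f x} ≤ ζ (Ioi t)) (R : ℝ) (j k : ℕ)
    (x : Ω) :
    P x ({ω | f (ω j) ≤ a} ∩ {ω | (fun i => ω (j + (1 + i))) ∈ aboveBeforeAt f a R k}) ≤
      ∫⁻ z, walkTail ζ a R k (a + z) ∂ξ := by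
  have := hP.1 x
  have hB := measurableSet_aboveBeforeAt hf a R k
  have hC : MeasurableSet {ω : ℕ → Ω | f (ω j) ≤ a} :=
    measurableSet_le (measurable_eval_path hf j) measurable_const
  have hstep : ∀ y, f y ≤ a → P y {ω | (fun i => ω (1 + i)) ∈ aboveBeforeAt f a R k} ≤
      ∫⁻ z, walkTail ζ a R k (a + z) ∂ξ := by
    intro y hy
    have hmarkov := hP.2.2 y 1 _ hB univ MeasurableSet.univ (by simp)
    rw [univ_inter, Measure.restrict_univ] at hmarkov
    rw [hmarkov]
    calc _ ≤ ∫⁻ ω, walkTail ζ a R k (f (ω 1)) ∂P y :=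
          lintegral_mono fun ω => measure_aboveBeforeAt_le hP hf hdom1 R k (ω 1)
      _ ≤ ∫⁻ z, walkTail ζ a R k (f y + z) ∂ξ :=
          lintegral_monotone_step_le hP hf (hdom0 y hy) (monotone_walkTail ζ a R k)
            (walkTail_le_one ζ a R k)
      _ ≤ _ := lintegral_mono fun z => monotone_walkTail ζ a R k (add_le_add_left hy z)
  have hmarkov := hP.2.2 x j {ω | (fun i => ω (1 + i)) ∈ aboveBeforeAt f a R k}
    (measurable_shift 1 hB) _ hC fun ω ω' h => by simp [h j le_rfl]
  refine (le_of_eq hmarkov).trans ((setLIntegral_mono' hC fun ω hω => hstep (ω j) hω).trans ?_)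
  rw [setLIntegral_const]
  exact mul_le_of_le_one_right zero_le prob_le_one

end Chain


/-- Conservation of mass under condition (SD): for every `ε > 0` there exists `R > 0`
with `P_x(f(X_n) > R) < ε + f(x)/(n λ₁)` for all `x` and `n ≥ 1`. -/
theorem stmt11 {Ω : Type*} [MeasurableSpace Ω] (P : Ω → Measure (ℕ → Ω))
    (hP : IsMarkovChainFamily P)
    (f : Ω → ℝ) (hf : Measurable f) (hf0 : ∀ x, 0 ≤ f x) (R₀ : ℝ)
    (ζ₀ ζ₁ : Measure ℝ) [IsProbabilityMeasure ζ₀] [IsProbabilityMeasure ζ₁]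
    (h0int : Integrable id ζ₀) (h1int : Integrable id ζ₁)
    (lam₁ : ℝ) (hlam₁ : 0 < lam₁) (hmean : ∫ z, z ∂ζ₁ = -lam₁)
    (hdom0 : ∀ x, f x ≤ R₀ → ∀ t : ℝ, P x {ω | t < f (ω 1) - f x} ≤ ζ₀ (Ioi t))
    (hdom1 : ∀ x, R₀ < f x → ∀ t : ℝ, P x {ω | t < f (ω 1) - f x} ≤ ζ₁ (Ioi t)) :
    ∀ ε : ℝ, 0 < ε → ∃ R : ℝ, 0 < R ∧ ∀ x : Ω, ∀ n : ℕ, 1 ≤ n →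
      P x {ω | R < f (ω n)} < ENNReal.ofReal ε + ENNReal.ofReal (f x / (n * lam₁)) := by
  intro ε hε
  have hε' : 0 < ENNReal.ofReal ε := ENNReal.ofReal_pos.2 hε
  obtain ⟨N, hN, hN0⟩ :=
    (((tendsto_tsum_lintegral_walkTail h0int h1int hlam₁ hmean R₀).eventually_lt_const hε').and
      (eventually_gt_atTop 0)).exists
  refine ⟨N, by exact_mod_cast hN0, fun x n hn => ?_⟩
  have hnl : 0 < n * lam₁ := mul_pos (by exact_mod_cast hn) hlam₁
  have hno_visit : P x (aboveBefore f R₀ n) ≤ ENNReal.ofReal (f x / (n * lam₁)) := by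
    rw [ENNReal.ofReal_div_of_pos hnl, ENNReal.le_div_iff_mul_le
      (Or.inl (ENNReal.ofReal_pos.2 hnl).ne') (Or.inl ENNReal.ofReal_ne_top)]
    exact measure_aboveBefore_mul_le hP hf hf0 h1int hlam₁ hmean hdom1 n x
  calc P x {ω | N < f (ω n)}
      ≤ P x (aboveBefore f R₀ n) + ∑ j ∈ Finset.range n, P x ({ω | f (ω j) ≤ R₀} ∩
          {ω | (fun i => ω (j + (1 + i))) ∈ aboveBeforeAt f R₀ N (n - 1 - j)}) :=
        (measure_mono (setOf_lt_subset_last_exit f R₀ N n)).trans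
          ((measure_union_le _ _).trans (add_le_add_right (measure_biUnion_finset_le _ _) _))
    _ ≤ P x (aboveBefore f R₀ n) + ∑ j ∈ Finset.range n,
          ∫⁻ z, walkTail ζ₁ R₀ N (n - 1 - j) (R₀ + z) ∂ζ₀ := by
        gcongr with j _
        exact measure_excursion_le hP hf hdom0 hdom1 N j (n - 1 - j) x
    _ ≤ ENNReal.ofReal (f x / (n * lam₁)) +
          ∑' k, ∫⁻ z, walkTail ζ₁ R₀ N k (R₀ + z) ∂ζ₀ := by
        rw [Finset.sum_range_reflect fun k => ∫⁻ z, walkTail ζ₁ R₀ N k (R₀ + z) ∂ζ₀]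
        exact add_le_add hno_visit (ENNReal.sum_le_tsum _)
    _ < ENNReal.ofReal (f x / (n * lam₁)) + ENNReal.ofReal ε :=
        ENNReal.add_lt_add_left ENNReal.ofReal_ne_top hN
    _ = _ := add_comm _ _
end

section
/- Under condition (SD) (increments of f along the Markov chain stochastically dominated by an integrable Z₀ on K = {f ≤ R₀} and by an integrable Z₁ with E[Z₁] < 0 outside K), for every ε > 0 there exists R > 0 such that for every x ∈ Ω, P_x-almost surely, limsup_{n→∞} (1/n)·#{k ∈ {1,…,n} : f(X_k) > R} < ε. -/
open MeasureTheory Set Filter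
open scoped ENNReal

open ProbabilityTheory
open scoped Topology

/-- The Kronecker lemma with weights `1 / (k + 1)`. -/
lemma tendsto_average_zero_of_tendsto_sum_div {a : ℕ → ℝ} {l : ℝ}
    (h : Tendsto (fun n => ∑ k ∈ Finset.range n, a k / (k + 1)) atTop (𝓝 l)) :
    Tendsto (fun n : ℕ => (n : ℝ)⁻¹ * ∑ k ∈ Finset.range n, a k) atTop (𝓝 0) := by
  set X : ℕ → ℝ := fun n => ∑ k ∈ Finset.range n, a k / (k + 1) with hX
  have hparts : ∀ n : ℕ,
      ∑ k ∈ Finset.range n, a k = n * X n - ∑ k ∈ Finset.range n, X k := by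
    intro n
    induction n with
    | zero => simp
    | succ n ih =>
      have hs : X (n + 1) = X n + a n / (n + 1) := by simp [hX, Finset.sum_range_succ]
      have hn : (n : ℝ) + 1 ≠ 0 := by positivity
      rw [Finset.sum_range_succ, Finset.sum_range_succ, ih, hs]
      push_cast
      field_simp
      ring
  have hlim := h.sub h.cesaro
  rw [sub_self] at hlim
  refine hlim.congr' ?_
  filter_upwards [eventually_ge_atTop 1] with n hn
  have hn' : (n : ℝ) ≠ 0 := by positivity
  rw [hparts, mul_sub, inv_mul_cancel_left₀ hn']

/-- A series of martingale differences with summable second moments converges almost surely. -/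
lemma ae_exists_tendsto_sum_of_condExp_eq_zero {Ω : Type*} {m0 : MeasurableSpace Ω}
    {μ : Measure Ω} [IsProbabilityMeasure μ] {ℱ : Filtration ℕ m0} {d : ℕ → Ω → ℝ} {v : ℕ → ℝ}
    {B : ℝ} (hd : ∀ n, StronglyMeasurable[ℱ (n + 1)] (d n)) (hL2 : ∀ n, MemLp (d n) 2 μ)
    (hcond : ∀ n, μ[d n | ℱ n] =ᵐ[μ] 0) (hv : ∀ n, ∫ ω, d n ω ^ 2 ∂μ ≤ v n)
    (hB : ∀ n, ∑ k ∈ Finset.range n, v k ≤ B) :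
    ∀ᵐ ω ∂μ, ∃ l, Tendsto (fun n => ∑ k ∈ Finset.range n, d k ω) atTop (𝓝 l) := by
  set X : ℕ → Ω → ℝ := fun n => ∑ k ∈ Finset.range n, d k with hX
  have hXs : ∀ n, X (n + 1) = X n + d n := fun n => Finset.sum_range_succ _ _
  have hXL2 : ∀ n, MemLp (X n) 2 μ := fun n => memLp_finsetSum' _ fun k _ => hL2 k
  have hadp : StronglyAdapted ℱ X := fun n =>
    Finset.stronglyMeasurable_sum _ fun k hk =>
      (hd k).mono (ℱ.mono (Nat.succ_le_of_lt (Finset.mem_range.1 hk)))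
  have hmart : Martingale X ℱ μ :=
    martingale_of_condExp_sub_eq_zero_nat hadp (fun n => (hXL2 n).integrable one_le_two) fun n => by
      rw [hXs, add_sub_cancel_left]
      exact hcond n
  have horth : ∀ n, ∫ ω, X n ω * d n ω ∂μ = 0 := by
    intro n
    have hmul : Integrable (X n * d n) μ := (hXL2 n).integrable_mul (hL2 n)
    calc ∫ ω, X n ω * d n ω ∂μ = ∫ ω, μ[X n * d n | ℱ n] ω ∂μ := (integral_condExp (ℱ.le n)).symm
      _ = ∫ ω, (0 : ℝ) ∂μ := by
        refine integral_congr_ae ?_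
        filter_upwards [condExp_mul_of_stronglyMeasurable_left (hadp n) hmul
          ((hL2 n).integrable one_le_two), hcond n] with ω h1 h2
        simp [h1, h2]
      _ = 0 := by simp
  have hsq : ∀ n, ∫ ω, X n ω ^ 2 ∂μ ≤ ∑ k ∈ Finset.range n, v k := by
    intro n
    induction n with
    | zero => simp [hX]
    | succ n ih =>
      have hmul : Integrable (fun ω => X n ω * d n ω) μ := (hXL2 n).integrable_mul (hL2 n)
      have hexp : ∫ ω, X (n + 1) ω ^ 2 ∂μ
          = ∫ ω, X n ω ^ 2 ∂μ + 2 * ∫ ω, X n ω * d n ω ∂μ + ∫ ω, d n ω ^ 2 ∂μ := by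
        have hadd : Integrable (fun ω => X n ω ^ 2 + 2 * (X n ω * d n ω)) μ :=
          (hXL2 n).integrable_sq.add (hmul.const_mul 2)
        rw [← integral_const_mul, ← integral_add (hXL2 n).integrable_sq (hmul.const_mul 2),
          ← integral_add hadd (hL2 n).integrable_sq]
        refine integral_congr_ae (Eventually.of_forall fun ω => ?_)
        simp only [hXs, Pi.add_apply]
        ring
      rw [hexp, horth, Finset.sum_range_succ]
      linarith [hv n]
  have hbdd : ∀ n, eLpNorm (X n) 1 μ ≤ ((1 + B).toNNReal : ℝ≥0∞) := by
    intro n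
    have hint : Integrable (X n) μ := (hXL2 n).integrable one_le_two
    rw [eLpNorm_one_eq_lintegral_enorm, ← ofReal_integral_norm_eq_lintegral_enorm hint]
    refine ENNReal.ofReal_le_ofReal ?_
    calc ∫ ω, ‖X n ω‖ ∂μ ≤ ∫ ω, (1 + X n ω ^ 2) ∂μ := by
          refine integral_mono hint.norm ((integrable_const 1).add (hXL2 n).integrable_sq) fun ω => ?_
          simp only [Real.norm_eq_abs]
          nlinarith [sq_abs (X n ω), sq_nonneg (|X n ω| - 1), abs_nonneg (X n ω)]
      _ = 1 + ∫ ω, X n ω ^ 2 ∂μ := by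
          rw [integral_add (integrable_const 1) (hXL2 n).integrable_sq]
          simp
      _ ≤ 1 + B := by linarith [hsq n, hB n]
  filter_upwards [hmart.submartingale.ae_tendsto_limitProcess hbdd] with ω hω
  refine ⟨_, hω.congr fun n => ?_⟩
  simp [hX, Finset.sum_apply]

/-- A tail comparison passes to the integral of a function whose superlevel sets on `[0, ∞)` are
empty or open half-lines. -/
lemma setIntegral_comp_le_of_tail_le {Ω Ω' : Type*} {m0 : MeasurableSpace Ω}
    {m1 : MeasurableSpace Ω'} {μ : Measure Ω} [IsFiniteMeasure μ] {ν : Measure Ω'}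
    {W : Ω → ℝ} {X : Ω' → ℝ} (hW : Measurable W) (hX : Measurable X) (hX0 : 0 ≤ X)
    {A : Set Ω} (hW0 : 0 ≤ W)
    (hdom : ∀ t : ℝ, 0 ≤ t → μ (A ∩ {ω | t < W ω}) ≤ μ A * ν {z | t < X z})
    {g : ℝ → ℝ} (hg : Measurable g) (hg0 : ∀ w, 0 ≤ w → 0 ≤ g w)
    (hlevel : ∀ t : ℝ, 0 < t → (∀ w, 0 ≤ w → g w ≤ t) ∨
      ∃ s, 0 ≤ s ∧ ∀ w, 0 ≤ w → (t < g w ↔ s < w))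
    (hgint : Integrable (fun z => g (X z)) ν) :
    ∫ ω in A, g (W ω) ∂μ ≤ μ.real A * ∫ z, g (X z) ∂ν := by
  rw [integral_eq_lintegral_of_nonneg_ae (Eventually.of_forall fun ω => hg0 _ (hW0 ω))
      (hg.comp hW).aestronglyMeasurable,
    integral_eq_lintegral_of_nonneg_ae (Eventually.of_forall fun z => hg0 _ (hX0 z))
      hgint.aestronglyMeasurable, measureReal_def, ← ENNReal.toReal_mul]
  refine ENNReal.toReal_mono (ENNReal.mul_ne_top (measure_ne_top _ _) ?_) ?_
  · exact ((hasFiniteIntegral_iff_ofReal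
      (Eventually.of_forall fun z => hg0 _ (hX0 z))).1 hgint.2).ne
  rw [lintegral_eq_lintegral_meas_lt _ (Eventually.of_forall fun ω => hg0 _ (hW0 ω))
      (hg.comp hW).aemeasurable,
    lintegral_eq_lintegral_meas_lt _ (Eventually.of_forall fun z => hg0 _ (hX0 z))
      (hg.comp hX).aemeasurable, ← lintegral_const_mul' _ _ (measure_ne_top _ _)]
  refine setLIntegral_mono' measurableSet_Ioi fun t ht => ?_
  have hmeas : MeasurableSet {ω | t < g (W ω)} := measurableSet_lt measurable_const (hg.comp hW)
  rw [Measure.restrict_apply hmeas, inter_comm]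
  rcases hlevel t ht with h | ⟨s, hs, h⟩
  · have he : {ω | t < g (W ω)} = ∅ := by
      ext ω
      simpa using h _ (hW0 ω)
    simp [he]
  · have h1 : {ω | t < g (W ω)} = {ω | s < W ω} := by
      ext ω
      exact h _ (hW0 ω)
    have h2 : {z | t < g (X z)} = {z | s < X z} := by
      ext z
      exact h _ (hX0 z)
    rw [h1, h2]
    exact hdom s hs

/-- The truncated second moments `E[min(X, k)²] / k²` of an integrable nonnegative variable have
bounded partial sums. -/
lemma exists_sum_integral_min_sq_div_le {Ω' : Type*} {m1 : MeasurableSpace Ω'} {ν : Measure Ω'}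
    [IsProbabilityMeasure ν] {X : Ω' → ℝ} (hXm : Measurable X) (hX : Integrable X ν)
    (hX0 : 0 ≤ X) :
    ∃ B, ∀ n, ∑ k ∈ Finset.range n, ((k : ℝ) ^ 2)⁻¹ * ∫ z, min (X z) k ^ 2 ∂ν ≤ B := by
  let : MeasureSpace Ω' := ⟨ν⟩
  have hprob : ∑' j : ℕ, ν {z | X z ∈ Ioi (j : ℝ)} < ∞ := tsum_prob_mem_Ioi_lt_top hX hX0
  have hsum : Summable fun j : ℕ => ν.real {z | X z ∈ Ioi (j : ℝ)} :=
    ENNReal.summable_toReal hprob.ne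
  refine ⟨2 * ∫ z, X z ∂ν + ∑' j : ℕ, ν.real {z | X z ∈ Ioi (j : ℝ)}, fun n => ?_⟩
  have hterm : ∀ k : ℕ, ((k : ℝ) ^ 2)⁻¹ * ∫ z, min (X z) k ^ 2 ∂ν
      ≤ ((k : ℝ) ^ 2)⁻¹ * ∫ z, (truncation X k ^ 2) z ∂ν + ν.real {z | X z ∈ Ioi (k : ℝ)} := by
    intro k
    have hk0 : (0 : ℝ) ≤ k := k.cast_nonneg
    have hmeas : MeasurableSet {z | X z ∈ Ioi (k : ℝ)} := hXm measurableSet_Ioi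
    have htr : Integrable (truncation X k ^ 2) ν :=
      (hXm.aestronglyMeasurable.memLp_truncation).integrable_sq
    have hind : Integrable ({z | X z ∈ Ioi (k : ℝ)}.indicator fun _ => (k : ℝ) ^ 2) ν :=
      (integrable_const _).indicator hmeas
    have hle : ∫ z, min (X z) k ^ 2 ∂ν
        ≤ ∫ z, (truncation X k ^ 2) z ∂ν + (k : ℝ) ^ 2 * ν.real {z | X z ∈ Ioi (k : ℝ)} := by
      calc ∫ z, min (X z) k ^ 2 ∂ν
          ≤ ∫ z, ((truncation X k ^ 2) z +
              {z | X z ∈ Ioi (k : ℝ)}.indicator (fun _ => (k : ℝ) ^ 2) z) ∂ν := by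
            refine integral_mono_of_nonneg (Eventually.of_forall fun z => sq_nonneg _)
              (htr.add hind) (Eventually.of_forall fun z => ?_)
            have hz := hX0 z
            simp only [Pi.zero_apply] at hz
            rw [truncation_eq_of_nonneg hX0]
            rcases le_or_gt (X z) k with h | h
            · rcases hz.eq_or_lt with h0 | h0
              · simp [indicator, ← h0, not_lt.2 hk0]
              · simp [indicator, h, h0, not_lt.2 h]
            · simp [indicator, h, not_le.2 h, h.le]
        _ = _ := by
            rw [integral_add htr hind, integral_indicator_const _ hmeas, smul_eq_mul, mul_comm]
    rcases hk0.eq_or_lt with h | h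
    · simp [← h]
    · calc _ ≤ ((k : ℝ) ^ 2)⁻¹ * (∫ z, (truncation X k ^ 2) z ∂ν
            + (k : ℝ) ^ 2 * ν.real {z | X z ∈ Ioi (k : ℝ)}) := by gcongr
        _ = _ := by field_simp
  calc _ ≤ ∑ k ∈ Finset.range n, (((k : ℝ) ^ 2)⁻¹ * ∫ z, (truncation X k ^ 2) z ∂ν
        + ν.real {z | X z ∈ Ioi (k : ℝ)}) := Finset.sum_le_sum fun k _ => hterm k
    _ ≤ _ := by
      rw [Finset.sum_add_distrib]
      exact add_le_add (sum_variance_truncation_le hX hX0 n)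
        (hsum.sum_le_tsum _ fun _ _ => measureReal_nonneg)

/-- One-sided strong law of large numbers: nonnegative variables `W k` supported on events `E k`
known at time `k`, and whose conditional tails on `E k` are bounded by those of an integrable `X`,
have averages asymptotically bounded by `E[X]` times the frequency of the events `E k`. -/
lemma ae_eventually_sum_le_of_conditional_tail_le {Ω Ω' : Type*} {m0 : MeasurableSpace Ω}
    {m1 : MeasurableSpace Ω'} {μ : Measure Ω} [IsProbabilityMeasure μ] {ν : Measure Ω'}
    [IsProbabilityMeasure ν] {ℱ : Filtration ℕ m0} {E : ℕ → Set Ω} {W : ℕ → Ω → ℝ} {X : Ω' → ℝ}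
    (hE : ∀ n, MeasurableSet[ℱ n] (E n)) (hW : ∀ n, Measurable[ℱ (n + 1)] (W n))
    (hW0 : ∀ n, 0 ≤ W n) (hWE : ∀ n, ∀ ω ∉ E n, W n ω = 0)
    (hXm : Measurable X) (hX : Integrable X ν) (hX0 : 0 ≤ X)
    (hdom : ∀ n C, MeasurableSet[ℱ n] C → ∀ t : ℝ, 0 ≤ t →
      μ (C ∩ E n ∩ {ω | t < W n ω}) ≤ μ (C ∩ E n) * ν {z | t < X z}) :
    ∀ᵐ ω ∂μ, ∀ δ : ℝ, 0 < δ → ∀ᶠ n : ℕ in atTop,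
      ∑ k ∈ Finset.range n, (W k ω - (E k).indicator (fun _ => ∫ z, X z ∂ν) ω) ≤ δ * n := by
  set m : ℝ := ∫ z, X z ∂ν with hm
  have hm0 : 0 ≤ m := integral_nonneg hX0
  have hWm : ∀ n, Measurable (W n) := fun n => (hW n).mono (ℱ.le _) le_rfl
  have hEm : ∀ n, MeasurableSet (E n) := fun n => ℱ.le n _ (hE n)
  set T : ℕ → Ω → ℝ := fun k ω => min (W k ω) k with hT
  have hT0 : ∀ k ω, 0 ≤ T k ω := fun k ω => le_min (hW0 k ω) k.cast_nonneg
  have hTk : ∀ k ω, T k ω ≤ k := fun k ω => min_le_right _ _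
  have hTadp : ∀ k, StronglyMeasurable[ℱ (k + 1)] (T k) := fun k =>
    ((hW k).min measurable_const).stronglyMeasurable
  have hTm : ∀ k, Measurable (T k) := fun k => (hWm k).min measurable_const
  have hTL2 : ∀ k, MemLp (T k) 2 μ := fun k =>
    MemLp.of_bound (hTm k).aestronglyMeasurable k (Eventually.of_forall fun ω => by
      rw [Real.norm_of_nonneg (hT0 k ω)]
      exact hTk k ω)
  have hTint : ∀ k, Integrable (T k) μ := fun k => (hTL2 k).integrable one_le_two
  have hTE : ∀ k, ∀ ω ∉ E k, T k ω = 0 := fun k ω hω => by simp [hT, hWE k ω hω]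
  have hXmin : ∀ k : ℕ, MemLp (fun z => min (X z) k) 2 ν := fun k =>
    MemLp.of_bound (hXm.min measurable_const).aestronglyMeasurable k
      (Eventually.of_forall fun z => by
        rw [Real.norm_of_nonneg (le_min (hX0 z) k.cast_nonneg)]
        exact min_le_right _ _)
  -- first moments of the truncated variables
  have hfirst : ∀ k C, MeasurableSet[ℱ k] C →
      ∫ ω in C, T k ω ∂μ ≤ ∫ ω in C, (E k).indicator (fun _ => m) ω ∂μ := by
    intro k C hC
    have hCm := ℱ.le k _ hC
    calc ∫ ω in C, T k ω ∂μ = ∫ ω in C ∩ E k, T k ω ∂μ :=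
          setIntegral_eq_of_subset_of_forall_sdiff_eq_zero hCm inter_subset_left
            fun ω hω => hTE k ω fun h => hω.2 ⟨hω.1, h⟩
      _ ≤ μ.real (C ∩ E k) * ∫ z, min (X z) k ∂ν := by
          refine setIntegral_comp_le_of_tail_le (g := fun w => min w k) (hWm k) hXm hX0
            (hW0 k) (hdom k C hC) (measurable_id.min measurable_const)
            (fun w hw => le_min hw k.cast_nonneg) (fun t ht => ?_)
            ((hXmin k).integrable one_le_two)
          rcases le_or_gt (k : ℝ) t with h | h
          · exact Or.inl fun w _ => (min_le_right _ _).trans h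
          · exact Or.inr ⟨t, ht.le, fun w _ => by simp [h]⟩
      _ ≤ μ.real (C ∩ E k) * m := by
          gcongr
          exact integral_mono ((hXmin k).integrable one_le_two) hX fun z => min_le_left _ _
      _ = _ := by
          rw [setIntegral_indicator (hEm k), setIntegral_const, smul_eq_mul]
  -- second moments of the truncated variables
  have hsecond : ∀ k : ℕ, ∫ ω, T k ω ^ 2 ∂μ ≤ ∫ z, min (X z) k ^ 2 ∂ν := by
    intro k
    have hsq0 : 0 ≤ ∫ z, min (X z) k ^ 2 ∂ν := integral_nonneg fun z => sq_nonneg _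
    calc ∫ ω, T k ω ^ 2 ∂μ = ∫ ω in univ ∩ E k, T k ω ^ 2 ∂μ := by
          rw [← setIntegral_univ]
          exact setIntegral_eq_of_subset_of_forall_sdiff_eq_zero MeasurableSet.univ
            inter_subset_left fun ω hω => by
              rw [hTE k ω fun h => hω.2 ⟨hω.1, h⟩, zero_pow two_ne_zero]
      _ ≤ μ.real (univ ∩ E k) * ∫ z, min (X z) k ^ 2 ∂ν := by
          refine setIntegral_comp_le_of_tail_le (g := fun w => min w k ^ 2) (hWm k) hXm hX0
            (hW0 k) (hdom k univ MeasurableSet.univ)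
            ((measurable_id.min measurable_const).pow_const 2)
            (fun w _ => sq_nonneg _) (fun t ht => ?_) (hXmin k).integrable_sq
          have hmin : ∀ w : ℝ, 0 ≤ w → (t < min w k ^ 2 ↔ √t < w ∧ √t < k) := fun w hw => by
            rw [← Real.sqrt_lt_sqrt_iff ht.le, Real.sqrt_sq (le_min hw k.cast_nonneg), lt_min_iff]
          rcases le_or_gt (k : ℝ) (√t) with h | h
          · refine Or.inl fun w hw => not_lt.1 fun hlt => ?_
            exact absurd ((hmin w hw).1 hlt).2 (not_lt.2 h)
          · exact Or.inr ⟨√t, Real.sqrt_nonneg t, fun w hw => by rw [hmin w hw, and_iff_left h]⟩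
      _ ≤ _ := mul_le_of_le_one_left hsq0 measureReal_le_one
  -- the compensator is at most `m` on `E k`
  set c : ℕ → Ω → ℝ := fun k => μ[T k | ℱ k] with hc
  have hcadp : ∀ k, StronglyMeasurable[ℱ k] (c k) := fun k => stronglyMeasurable_condExp
  have hcle : ∀ k, c k ≤ᵐ[μ] (E k).indicator fun _ => m := by
    intro k
    have hind : StronglyMeasurable[ℱ k] ((E k).indicator fun _ => m) :=
      stronglyMeasurable_const.indicator (hE k)
    have hindint : Integrable ((E k).indicator fun _ => m) μ :=
      (integrable_const _).indicator (hEm k)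
    refine ae_le_of_ae_le_trim (hm := ℱ.le k) ?_
    refine ae_le_of_forall_setIntegral_le (integrable_condExp.trim (ℱ.le k) (hcadp k))
      (hindint.trim (ℱ.le k) hind) fun C hC _ => ?_
    rw [← setIntegral_trim (ℱ.le k) (hcadp k) hC, ← setIntegral_trim (ℱ.le k) hind hC,
      setIntegral_condExp (ℱ.le k) (hTint k) hC]
    exact hfirst k C hC
  have hc0 : ∀ k, 0 ≤ᵐ[μ] c k := fun k => condExp_nonneg (Eventually.of_forall (hT0 k))
  have hcL2 : ∀ k, MemLp (c k) 2 μ := fun k =>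
    MemLp.of_bound integrable_condExp.aestronglyMeasurable m (by
      filter_upwards [hc0 k, hcle k] with ω h0 h1
      rw [Real.norm_of_nonneg h0]
      exact h1.trans (indicator_le_self' (fun _ _ => hm0) ω))
  -- convergence of the weighted martingale
  set d : ℕ → Ω → ℝ := fun k => ((k : ℝ) + 1)⁻¹ • (T k - c k) with hd
  obtain ⟨B, hB⟩ := exists_sum_integral_min_sq_div_le hXm hX hX0
  have hinv : Summable fun k : ℕ => m ^ 2 * (((k : ℝ) + 1) ^ 2)⁻¹ := by
    have h := (summable_nat_add_iff 1).2 (Real.summable_nat_pow_inv.2 one_lt_two)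
    push_cast at h
    exact h.mul_left _
  have hconv : ∀ᵐ ω ∂μ, ∃ l, Tendsto (fun n => ∑ k ∈ Finset.range n, d k ω) atTop (𝓝 l) := by
    refine ae_exists_tendsto_sum_of_condExp_eq_zero (ℱ := ℱ)
      (v := fun k => ((k : ℝ) ^ 2)⁻¹ * ∫ z, min (X z) k ^ 2 ∂ν + m ^ 2 * (((k : ℝ) + 1) ^ 2)⁻¹)
      (B := B + ∑' k : ℕ, m ^ 2 * (((k : ℝ) + 1) ^ 2)⁻¹) (fun k => ?_) (fun k => ?_)
      (fun k => ?_) (fun k => ?_) (fun n => ?_)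
    · exact ((hTadp k).sub ((hcadp k).mono (ℱ.mono k.le_succ))).const_smul _
    · exact ((hTL2 k).sub (hcL2 k)).const_smul _
    · have hself : μ[c k | ℱ k] = c k :=
        condExp_of_stronglyMeasurable (ℱ.le k) (hcadp k) integrable_condExp
      filter_upwards [condExp_smul (μ := μ) ((k : ℝ) + 1)⁻¹ (T k - c k) (ℱ k),
        condExp_sub (hTint k) (integrable_condExp (f := T k) (μ := μ) (m := ℱ k)) (ℱ k)]
        with ω h1 h2
      rw [h1, Pi.smul_apply, h2, Pi.sub_apply, hself]
      simp [hc]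
    · have hle : ∫ ω, d k ω ^ 2 ∂μ ≤ (((k : ℝ) + 1) ^ 2)⁻¹ * (∫ ω, T k ω ^ 2 ∂μ + m ^ 2) := by
        have hrhs : ∫ ω, (T k ω ^ 2 + m ^ 2) ∂μ = ∫ ω, T k ω ^ 2 ∂μ + m ^ 2 := by
          rw [integral_add (hTL2 k).integrable_sq (integrable_const _)]
          simp
        rw [← hrhs, ← integral_const_mul]
        refine integral_mono_of_nonneg (Eventually.of_forall fun ω => sq_nonneg _)
          (((hTL2 k).integrable_sq.add (integrable_const _)).const_mul _) ?_
        filter_upwards [hc0 k, hcle k] with ω h0 h1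
        have h2 : c k ω ≤ m := h1.trans (indicator_le_self' (fun _ _ => hm0) ω)
        have h0' : 0 ≤ c k ω := h0
        simp only [hd, Pi.smul_apply, Pi.sub_apply, smul_eq_mul, mul_pow, inv_pow]
        gcongr
        nlinarith [hT0 k ω, mul_nonneg (hT0 k ω) h0']
      refine hle.trans ?_
      rw [mul_add, mul_comm (_⁻¹) (m ^ 2)]
      gcongr ?_ + _
      rcases k.eq_zero_or_pos with rfl | hk
      · have hz : ∀ ω, T 0 ω = 0 := fun ω => le_antisymm (by simpa using hTk 0 ω) (hT0 0 ω)
        simp [hz]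
      · have hk' : (0 : ℝ) < k := Nat.cast_pos.2 hk
        have := hsecond k
        have h0 : 0 ≤ ∫ ω, T k ω ^ 2 ∂μ := integral_nonneg fun ω => sq_nonneg _
        gcongr
        linarith
    · rw [Finset.sum_add_distrib]
      exact add_le_add (hB n) (hinv.sum_le_tsum _ fun k _ => by positivity)
  -- truncation is eventually inactive
  have htrunc : ∀ᵐ ω ∂μ, ∀ᶠ k : ℕ in atTop, ω ∉ {ω | (k : ℝ) < W k ω} := by
    have hsumX : ∑' k : ℕ, ν {z | (k : ℝ) < X z} ≠ ∞ := by
      let : MeasureSpace Ω' := ⟨ν⟩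
      exact (tsum_prob_mem_Ioi_lt_top hX hX0).ne
    refine ae_eventually_notMem (ne_top_of_le_ne_top hsumX (ENNReal.tsum_le_tsum fun k => ?_))
      (s := fun k : ℕ => {ω | (k : ℝ) < W k ω})
    calc μ {ω | (k : ℝ) < W k ω} ≤ μ (univ ∩ E k ∩ {ω | (k : ℝ) < W k ω}) := by
          refine measure_mono fun ω hω => ⟨⟨mem_univ _, ?_⟩, hω⟩
          by_contra h
          have hω' : (k : ℝ) < W k ω := hω
          rw [hWE k ω h] at hω'
          exact absurd hω' (not_lt.2 k.cast_nonneg)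
      _ ≤ μ (univ ∩ E k) * ν {z | (k : ℝ) < X z} :=
          hdom k univ MeasurableSet.univ k k.cast_nonneg
      _ ≤ _ := mul_le_of_le_one_left' prob_le_one
  filter_upwards [hconv, htrunc, ae_all_iff.2 hcle] with ω ⟨l, hl⟩ htr hle δ hδ
  have hkron : Tendsto (fun n : ℕ => (n : ℝ)⁻¹ * ∑ k ∈ Finset.range n, (T k ω - c k ω)) atTop
      (𝓝 0) :=
    tendsto_average_zero_of_tendsto_sum_div (hl.congr fun n => Finset.sum_congr rfl fun k _ => by
      simp [hd, div_eq_inv_mul])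
  have hrest : Tendsto (fun n : ℕ => (n : ℝ)⁻¹ * ∑ k ∈ Finset.range n, (W k ω - T k ω)) atTop
      (𝓝 0) := by
    refine Tendsto.cesaro (tendsto_const_nhds.congr' ?_)
    filter_upwards [htr] with k hk
    simp [hT, not_lt.1 hk]
  have hsum := hkron.add hrest
  rw [add_zero] at hsum
  filter_upwards [hsum.eventually_lt_const hδ, eventually_ge_atTop 1] with n hn hn1
  have hn0 : (0 : ℝ) < n := by exact_mod_cast hn1
  rw [← mul_add, ← Finset.sum_add_distrib, inv_mul_lt_iff₀ hn0] at hn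
  calc _ ≤ ∑ k ∈ Finset.range n, (T k ω - c k ω + (W k ω - T k ω)) :=
        Finset.sum_le_sum fun k _ => by linarith [hle k]
    _ ≤ δ * n := by linarith

/-- The one-sided strong law for the truncated increments of `f` along a Markov chain, taken at
the times when `f` lies in a set `E` on which these increments are stochastically dominated. -/
lemma IsMarkovChainFamily.ae_eventually_sum_increments_le {Ω : Type*} [MeasurableSpace Ω]
    {P : Ω → Measure (ℕ → Ω)} (hP : IsMarkovChainFamily P) {f : Ω → ℝ} (hf : Measurable f)
    {E : Set ℝ} (hE : MeasurableSet E) {ζ : Measure ℝ} [IsProbabilityMeasure ζ]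
    (hint : Integrable id ζ)
    (hdom : ∀ x, f x ∈ E → ∀ t : ℝ, P x {ω | t < f (ω 1) - f x} ≤ ζ (Ioi t)) (a : ℝ) (x : Ω) :
    ∀ᵐ ω ∂P x, ∀ δ : ℝ, 0 < δ → ∀ᶠ n : ℕ in atTop,
      ∑ k ∈ Finset.range n, E.indicator
        (fun y => max (f (ω (k + 1)) - y + a) 0 - ∫ z, max (z + a) 0 ∂ζ) (f (ω k)) ≤ δ * n := by
  obtain ⟨hprob, hstart, hmarkov⟩ := hP
  have := hprob x
  let ℱ : Filtration ℕ (MeasurableSpace.pi : MeasurableSpace (ℕ → Ω)) := Filtration.piLE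
  have hcoord : ∀ n k, k ≤ n → Measurable[ℱ n] fun ω : ℕ → Ω => f (ω k) := by
    intro n k hk
    have h : Measurable fun u : Iic n → Ω => f (u ⟨k, hk⟩) := hf.comp (measurable_pi_apply _)
    exact fun s hs => ⟨_, h hs, rfl⟩
  have hdet : ∀ n C, MeasurableSet[ℱ n] C →
      ∀ ω ω' : ℕ → Ω, (∀ k ≤ n, ω k = ω' k) → (ω ∈ C ↔ ω' ∈ C) := by
    rintro n C ⟨C', -, rfl⟩ ω ω' h
    have : Preorder.restrictLe n ω = Preorder.restrictLe (π := fun _ => Ω) n ω' :=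
      funext fun k => h k k.2
    simp [this]
  let A : ℕ → Set (ℕ → Ω) := fun n => {ω | f (ω n) ∈ E}
  have hA : ∀ n, MeasurableSet[ℱ n] (A n) := fun n => hcoord n n le_rfl hE
  let W : ℕ → (ℕ → Ω) → ℝ := fun n => (A n).indicator fun ω => max (f (ω (n + 1)) - f (ω n) + a) 0
  have hW : ∀ n, Measurable[ℱ (n + 1)] (W n) := fun n =>
    ((((hcoord (n + 1) (n + 1) le_rfl).sub (hcoord (n + 1) n n.le_succ)).add_const a).max
      measurable_const).indicator (ℱ.mono n.le_succ _ (hA n))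
  have hW0 : ∀ n, 0 ≤ W n := fun n ω => indicator_nonneg (fun _ _ => le_max_right _ _) ω
  have hstep : ∀ y, f y ∈ E → ∀ t : ℝ, P y {ω | t < f (ω 1) - f (ω 0)} ≤ ζ (Ioi t) := by
    intro y hy t
    have := hprob y
    have hy0 : ∀ᵐ ω ∂P y, f (ω 0) = f y := by
      have hmeas : MeasurableSet {ω : ℕ → Ω | f (ω 0) = f y} :=
        (hf.comp (measurable_pi_apply 0)) (measurableSet_singleton _)
      refine (prob_compl_eq_zero_iff hmeas).2 (le_antisymm prob_le_one ?_)
      rw [← hstart y]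
      exact measure_mono fun ω (hω : ω 0 = y) => congrArg f hω
    refine (measure_mono_ae ?_).trans (hdom y hy t)
    filter_upwards [hy0] with ω hω (h : t < f (ω 1) - f (ω 0))
    rwa [hω] at h
  have htail : ∀ n C, MeasurableSet[ℱ n] C → ∀ t : ℝ, 0 ≤ t →
      P x (C ∩ A n ∩ {ω | t < W n ω}) ≤ P x (C ∩ A n) * ζ {z | t < max (z + a) 0} := by
    intro n C hC t ht
    have hCA : MeasurableSet[ℱ n] (C ∩ A n) := hC.inter (hA n)
    have hB : MeasurableSet {ω : ℕ → Ω | t - a < f (ω 1) - f (ω 0)} :=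
      measurableSet_lt measurable_const
        ((hf.comp (measurable_pi_apply 1)).sub (hf.comp (measurable_pi_apply 0)))
    have hset : {z : ℝ | t < max (z + a) 0} = Ioi (t - a) := by
      ext z
      simp [not_lt.2 ht, sub_lt_iff_lt_add]
    calc P x (C ∩ A n ∩ {ω | t < W n ω})
        ≤ P x (C ∩ A n ∩
            {ω | (fun k => ω (n + k)) ∈ {ω : ℕ → Ω | t - a < f (ω 1) - f (ω 0)}}) := by
          refine measure_mono fun ω hω => ⟨hω.1, ?_⟩
          have h : t < W n ω := hω.2
          simp only [W, indicator_of_mem hω.1.2, lt_max_iff, not_lt.2 ht, or_false] at h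
          simpa [sub_lt_iff_lt_add] using h
      _ = ∫⁻ ω in C ∩ A n, P (ω n) {ω | t - a < f (ω 1) - f (ω 0)} ∂P x :=
          hmarkov x n _ hB _ (ℱ.le n _ hCA) (hdet n _ hCA)
      _ ≤ ∫⁻ _ in C ∩ A n, ζ (Ioi (t - a)) ∂P x :=
          setLIntegral_mono' (ℱ.le n _ hCA) fun ω hω => hstep _ hω.2 _
      _ = _ := by rw [setLIntegral_const, hset, mul_comm]
  have hXint : Integrable (fun z : ℝ => max (z + a) 0) ζ :=
    (hint.add (integrable_const a)).pos_part
  filter_upwards [ae_eventually_sum_le_of_conditional_tail_le hA hW hW0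
    (fun n ω hω => indicator_of_notMem hω _) ((measurable_id.add_const a).max measurable_const)
    hXint (fun z => le_max_right _ _) htail] with ω hω δ hδ
  filter_upwards [hω δ hδ] with n hn
  refine le_of_eq_of_le (Finset.sum_congr rfl fun k _ => ?_) hn
  by_cases h : f (ω k) ∈ E
  · have h' : ω ∈ A k := h
    simp [W, h, h']
  · have h' : ω ∉ A k := h
    simp [W, h, h']

/-- Truncation levels at which the means of the truncated variable are close to their limits. -/
lemma eventually_integral_max_lt {ζ : Measure ℝ} [IsProbabilityMeasure ζ]
    (hint : Integrable id ζ) {δ : ℝ} (hδ : 0 < δ) :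
    ∀ᶠ S : ℝ in atTop, ∫ z, max (z + -S) 0 ∂ζ < δ ∧
      ∫ z, max (z + S) 0 ∂ζ < S + ∫ z, z ∂ζ + δ := by
  have hupper : Tendsto (fun S : ℝ => ∫ z, max (z + -S) 0 ∂ζ) atTop (𝓝 (∫ _, (0 : ℝ) ∂ζ)) := by
    refine tendsto_integral_filter_of_dominated_convergence (fun z => |z|)
      (Eventually.of_forall fun S => by fun_prop) ?_ hint.abs (Eventually.of_forall fun z => ?_)
    · filter_upwards [eventually_ge_atTop 0] with S hS
      refine Eventually.of_forall fun z => ?_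
      rw [Real.norm_of_nonneg (le_max_right _ _)]
      exact max_le (by linarith [le_abs_self z]) (abs_nonneg z)
    · refine tendsto_const_nhds.congr' ?_
      filter_upwards [eventually_ge_atTop z] with S hS
      exact (max_eq_right (by linarith)).symm
  have hlower : Tendsto (fun S : ℝ => ∫ z, max z (-S) ∂ζ) atTop (𝓝 (∫ z, z ∂ζ)) := by
    refine tendsto_integral_filter_of_dominated_convergence (fun z => |z|)
      (Eventually.of_forall fun S => by fun_prop) ?_ hint.abs (Eventually.of_forall fun z => ?_)
    · filter_upwards [eventually_ge_atTop 0] with S hS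
      refine Eventually.of_forall fun z => ?_
      rw [Real.norm_eq_abs, abs_le]
      exact ⟨(neg_abs_le z).trans (le_max_left _ _),
        max_le (le_abs_self z) (by linarith [abs_nonneg z])⟩
    · refine tendsto_const_nhds.congr' ?_
      filter_upwards [eventually_ge_atTop (-z)] with S hS
      exact (max_eq_left (by linarith)).symm
  rw [integral_zero] at hupper
  filter_upwards [hupper.eventually_lt_const hδ,
    hlower.eventually_lt_const (lt_add_of_pos_right _ hδ)] with S h1 h2
  refine ⟨h1, ?_⟩
  have hmax : Integrable (fun z => max z (-S)) ζ := hint.sup (integrable_const _)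
  have heq : ∫ z, max (z + S) 0 ∂ζ = ∫ z, max z (-S) ∂ζ + S := by
    have hconst : ∫ z, (max z (-S) + S) ∂ζ = ∫ z, max z (-S) ∂ζ + S := by
      rw [integral_add hmax (integrable_const _)]
      simp
    rw [← hconst]
    refine integral_congr_ae (Eventually.of_forall fun z => ?_)
    simp [← max_add_add_right]
  linarith

/-- The number of times before `n` at which `y` exceeds `r`. -/
noncomputable def exceedanceCount (y : ℕ → ℝ) (r : ℝ) (n : ℕ) : ℝ :=
  ∑ k ∈ Finset.range n, (Ioi r).indicator 1 (y k)

/-- Drift inequality for the potential `(y - L)⁺` along a path: exceedances above `L + S` are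
controlled by the visits to the window `(L - S, L + S]`. -/
lemma eventually_exceedanceCount_le_window {y : ℕ → ℝ} {R₀ L S M₀ M₁ c M₂ δ lam : ℝ}
    (hL : R₀ ≤ L - S) (hS : 0 < S) (hδ : 0 < δ) (hM₀ : M₀ ≤ δ) (hM₁ : M₁ ≤ δ)
    (hM₂ : M₂ ≤ S - lam)
    (h₀ : ∀ᶠ n : ℕ in atTop, ∑ k ∈ Finset.range n, (Iic R₀).indicator
      (fun u => max (y (k + 1) - u + -S) 0 - M₀) (y k) ≤ δ * n)
    (h₁ : ∀ᶠ n : ℕ in atTop, ∑ k ∈ Finset.range n, (Ioc R₀ (L - S)).indicator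
      (fun u => max (y (k + 1) - u + -S) 0 - M₁) (y k) ≤ δ * n)
    (hc : ∀ᶠ n : ℕ in atTop, ∑ k ∈ Finset.range n, (Ioc (L - S) (L + S)).indicator
      (fun u => max (y (k + 1) - u + 0) 0 - c) (y k) ≤ δ * n)
    (h₂ : ∀ᶠ n : ℕ in atTop, ∑ k ∈ Finset.range n, (Ioi (L + S)).indicator
      (fun u => max (y (k + 1) - u + S) 0 - M₂) (y k) ≤ δ * n) :
    ∀ᶠ n : ℕ in atTop, lam * exceedanceCount y (L + S) n ≤
      6 * δ * n + c * (exceedanceCount y (L - S) n - exceedanceCount y (L + S) n) := by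
  have hV0 : ∀ᶠ n : ℕ in atTop, max (y 0 - L) 0 ≤ δ * n := by
    filter_upwards [tendsto_natCast_atTop_atTop.eventually_ge_atTop (max (y 0 - L) 0 / δ)]
      with n hn
    rwa [div_le_iff₀' hδ] at hn
  filter_upwards [h₀, h₁, hc, h₂, hV0] with n k₀ k₁ kc k₂ kV
  have hstep : ∀ k, max (y (k + 1) - L) 0 - max (y k - L) 0 ≤
      (Iic R₀).indicator (fun u => max (y (k + 1) - u + -S) 0 - M₀) (y k) +
      (Ioc R₀ (L - S)).indicator (fun u => max (y (k + 1) - u + -S) 0 - M₁) (y k) +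
      (Ioc (L - S) (L + S)).indicator (fun u => max (y (k + 1) - u + 0) 0 - c) (y k) +
      (Ioi (L + S)).indicator (fun u => max (y (k + 1) - u + S) 0 - M₂) (y k) + δ +
      c * ((Ioi (L - S)).indicator 1 (y k) - (Ioi (L + S)).indicator 1 (y k)) -
      lam * (Ioi (L + S)).indicator 1 (y k) := by
    intro k
    have hlow : y k ≤ L - S → max (y (k + 1) - L) 0 - max (y k - L) 0 ≤
        max (y (k + 1) - y k + -S) 0 := fun h => by
      have h1 := le_max_right (y k - L) 0
      have h2 : max (y (k + 1) - L) 0 ≤ max (y (k + 1) - y k + -S) 0 :=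
        max_le_max_right 0 (by linarith)
      linarith
    rcases le_or_gt (y k) R₀ with h | h
    · have e1 : ¬ L - S < y k := by linarith
      have e2 : ¬ L + S < y k := by linarith
      have := hlow (by linarith)
      simp only [indicator, mem_Iic, mem_Ioc, mem_Ioi, h, not_lt.2 h, e1, e2, if_true, if_false,
        false_and, Pi.one_apply]
      linarith
    rcases le_or_gt (y k) (L - S) with h' | h'
    · have e2 : ¬ L + S < y k := by linarith
      have := hlow h'
      simp only [indicator, mem_Iic, mem_Ioc, mem_Ioi, h, not_le.2 h, h', not_lt.2 h', e2,
        if_true, if_false, true_and, false_and, Pi.one_apply]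
      linarith
    rcases le_or_gt (y k) (L + S) with h'' | h''
    · have : max (y (k + 1) - L) 0 - max (y k - L) 0 ≤ max (y (k + 1) - y k + 0) 0 := by
        rw [sub_le_iff_le_add]
        refine max_le ?_ (by positivity)
        linarith [le_max_left (y k - L) 0, le_max_left (y (k + 1) - y k + 0) 0]
      simp only [indicator, mem_Iic, mem_Ioc, mem_Ioi, h, not_le.2 h, h', not_le.2 h', h'',
        not_lt.2 h'', if_true, if_false, true_and, and_false, Pi.one_apply]
      linarith
    · have : max (y (k + 1) - L) 0 - max (y k - L) 0 ≤ max (y (k + 1) - y k + S) 0 - S := by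
        have h1 := le_max_left (y k - L) 0
        rw [sub_le_iff_le_add]
        refine max_le ?_ ?_
        · linarith [le_max_left (y (k + 1) - y k + S) 0]
        · linarith [le_max_right (y (k + 1) - y k + S) 0]
      simp only [indicator, mem_Iic, mem_Ioc, mem_Ioi, not_le.2 h, h', not_le.2 h', h'',
        not_le.2 h'', if_true, if_false, and_false, Pi.one_apply]
      linarith
  have htele := Finset.sum_range_sub (fun k => max (y k - L) 0) n
  have hsum := Finset.sum_le_sum fun k (_ : k ∈ Finset.range n) => hstep k
  simp only [Finset.sum_add_distrib, Finset.sum_sub_distrib, ← Finset.mul_sum, Finset.sum_const,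
    Finset.card_range, nsmul_eq_mul] at hsum htele
  have hVn := le_max_right (y n - L) 0
  unfold exceedanceCount
  linarith

/-- Summing the drift inequality over `m` adjacent windows. -/
lemma mul_exceedanceCount_le_of_windows {y : ℕ → ℝ} {r s lam κ c : ℝ} {n : ℕ} (hs : 0 ≤ s)
    (hlam : 0 ≤ lam) (hc : 0 ≤ c) (m : ℕ)
    (h : ∀ j < m, lam * exceedanceCount y (r + s * (j + 1 : ℕ)) n ≤ κ * n +
      c * (exceedanceCount y (r + s * j) n - exceedanceCount y (r + s * (j + 1 : ℕ)) n)) :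
    lam * m * exceedanceCount y (r + s * m) n ≤ (m * κ + c) * n := by
  have hanti : Antitone fun u => exceedanceCount y u n := fun u v huv =>
    Finset.sum_le_sum fun k _ =>
      indicator_le_indicator_of_subset (Ioi_subset_Ioi huv) (fun _ => zero_le_one) _
  have hle : exceedanceCount y r n ≤ n := by
    calc exceedanceCount y r n ≤ ∑ k ∈ Finset.range n, (1 : ℝ) :=
          Finset.sum_le_sum fun k _ => indicator_le_self' (fun _ _ => zero_le_one) _
      _ = n := by simp
  have hnonneg : 0 ≤ exceedanceCount y (r + s * m) n :=
    Finset.sum_nonneg fun k _ => indicator_nonneg (fun _ _ => zero_le_one) _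
  have hsum : ∑ j ∈ Finset.range m, lam * exceedanceCount y (r + s * m) n ≤
      ∑ j ∈ Finset.range m, (κ * n +
        c * (exceedanceCount y (r + s * j) n - exceedanceCount y (r + s * (j + 1 : ℕ)) n)) := by
    refine Finset.sum_le_sum fun j hj => le_trans ?_ (h j (Finset.mem_range.1 hj))
    refine mul_le_mul_of_nonneg_left (hanti ?_) hlam
    have : ((j + 1 : ℕ) : ℝ) ≤ m := by exact_mod_cast Finset.mem_range.1 hj
    gcongr
  rw [Finset.sum_add_distrib] at hsum
  simp only [← Finset.mul_sum] at hsum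
  rw [Finset.sum_range_sub' (fun j : ℕ => exceedanceCount y (r + s * j) n) m] at hsum
  simp only [Finset.sum_const, Finset.card_range, nsmul_eq_mul, Nat.cast_zero, mul_zero,
    add_zero] at hsum
  nlinarith [mul_le_mul_of_nonneg_left hle hc, mul_nonneg hc hnonneg]

/-- Eventual bounds on exceedance counts pass to the upper frequency. -/
lemma limsup_card_filter_div_lt {y : ℕ → ℝ} {R η ε : ℝ} (hηε : η < ε)
    (h : ∀ᶠ n : ℕ in atTop, exceedanceCount y R n ≤ η * n) :
    limsup (fun n : ℕ =>
      (((Finset.Icc 1 n).filter (fun k => R < y k)).card : ℝ) / n) atTop < ε := by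
  have hcard : ∀ n : ℕ, (((Finset.Icc 1 n).filter (fun k => R < y k)).card : ℝ)
      ≤ exceedanceCount y R (n + 1) := by
    intro n
    have hcount : exceedanceCount y R (n + 1)
        = (((Finset.range (n + 1)).filter (fun k => R < y k)).card : ℝ) := by
      simp [exceedanceCount, indicator, Finset.sum_boole]
    rw [hcount]
    refine Nat.cast_le.2 (Finset.card_le_card (Finset.filter_subset_filter _ fun k hk => ?_))
    simp only [Finset.mem_Icc, Finset.mem_range] at hk ⊢
    lia
  obtain ⟨η', h1, h2⟩ := exists_between hηε
  have hbound : ∀ᶠ n : ℕ in atTop,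
      (((Finset.Icc 1 n).filter (fun k => R < y k)).card : ℝ) / n ≤ η' := by
    filter_upwards [(tendsto_add_atTop_nat 1).eventually h, eventually_ge_atTop 1,
      tendsto_natCast_atTop_atTop.eventually_ge_atTop (η / (η' - η))] with n hn hn1 hnη
    have hn0 : (0 : ℝ) < n := by exact_mod_cast hn1
    rw [div_le_iff₀' (by linarith)] at hnη
    rw [div_le_iff₀ hn0]
    push_cast at hn
    linarith [hcard n]
  refine lt_of_le_of_lt (limsup_le_of_le ?_ hbound) h2
  exact IsBoundedUnder.isCoboundedUnder_le
    ⟨0, eventually_map.2 (Eventually.of_forall fun n => by positivity)⟩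

/-- Recurrence of empirical measures under condition (SD): for every `ε > 0` there is
`R > 0` such that for every starting point `x`, `P_x`-almost surely
`limsup_n (1/n) #{k ≤ n : f(X_k) > R} < ε`. -/
theorem stmt12 {Ω : Type*} [MeasurableSpace Ω] (P : Ω → Measure (ℕ → Ω))
    (hP : IsMarkovChainFamily P)
    (f : Ω → ℝ) (hf : Measurable f) (hf0 : ∀ x, 0 ≤ f x) (R₀ : ℝ)
    (ζ₀ ζ₁ : Measure ℝ) [IsProbabilityMeasure ζ₀] [IsProbabilityMeasure ζ₁]
    (h0int : Integrable id ζ₀) (h1int : Integrable id ζ₁)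
    (lam₁ : ℝ) (hlam₁ : 0 < lam₁) (hmean : ∫ z, z ∂ζ₁ = -lam₁)
    (hdom0 : ∀ x, f x ≤ R₀ → ∀ t : ℝ, P x {ω | t < f (ω 1) - f x} ≤ ζ₀ (Ioi t))
    (hdom1 : ∀ x, R₀ < f x → ∀ t : ℝ, P x {ω | t < f (ω 1) - f x} ≤ ζ₁ (Ioi t)) :
    ∀ ε : ℝ, 0 < ε → ∃ R : ℝ, 0 < R ∧ ∀ x : Ω, ∀ᵐ ω ∂ P x,
      Filter.limsup (fun n : ℕ =>
          (((Finset.Icc 1 n).filter (fun k => R < f (ω k))).card : ℝ) / n) Filter.atTop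
        < ε := by
  intro ε hε
  set c : ℝ := ∫ z, max (z + 0) 0 ∂ζ₁ with hc
  have hc0 : 0 ≤ c := integral_nonneg fun z => le_max_right _ _
  set δ : ℝ := min (ε * lam₁ / 48) (lam₁ / 2) with hδdef
  have hδ : 0 < δ := by positivity
  obtain ⟨S, ⟨hS₀, -⟩, ⟨hS₁, hS₂⟩, hS⟩ := ((eventually_integral_max_lt h0int hδ).and
    ((eventually_integral_max_lt h1int hδ).and (eventually_gt_atTop 0))).exists
  rw [hmean] at hS₂
  obtain ⟨m, hm⟩ := exists_nat_gt (8 * c / (ε * lam₁))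
  have hm0 : (0 : ℝ) < m := lt_of_le_of_lt (by positivity) hm
  rw [div_lt_iff₀ (by positivity)] at hm
  set r : ℝ := max R₀ 0 with hr
  refine ⟨r + 2 * S * m, by positivity, fun x => ?_⟩
  set L : ℕ → ℝ := fun j => r + 2 * S * j + S with hL
  have hdomK : ∀ x, f x ∈ Iic R₀ → ∀ t : ℝ, P x {ω | t < f (ω 1) - f x} ≤ ζ₀ (Ioi t) := hdom0
  have hR₀L : ∀ j, R₀ ≤ L j - S := fun j => by
    have : 0 ≤ 2 * S * j := by positivity
    simp only [hL]
    linarith [le_max_left R₀ 0]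
  have hlow : ∀ᵐ ω ∂P x, ∀ j, _ := ae_all_iff.2 fun j =>
    hP.ae_eventually_sum_increments_le hf (E := Ioc R₀ (L j - S)) measurableSet_Ioc h1int
      (fun x hx => hdom1 x hx.1) (-S) x
  have hwin : ∀ᵐ ω ∂P x, ∀ j, _ := ae_all_iff.2 fun j =>
    hP.ae_eventually_sum_increments_le hf (E := Ioc (L j - S) (L j + S)) measurableSet_Ioc h1int
      (fun x hx => hdom1 x ((hR₀L j).trans_lt hx.1)) 0 x
  have hhigh : ∀ᵐ ω ∂P x, ∀ j, _ := ae_all_iff.2 fun j =>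
    hP.ae_eventually_sum_increments_le hf (E := Ioi (L j + S)) measurableSet_Ioi h1int
      (fun x (hx : L j + S < f x) => hdom1 x (by linarith [hR₀L j])) S x
  filter_upwards [hP.ae_eventually_sum_increments_le hf measurableSet_Iic h0int hdomK (-S) x,
    hlow, hwin, hhigh] with ω g₀ g₁ gc g₂
  have hdrift : ∀ᶠ n : ℕ in atTop, ∀ j < m,
      lam₁ / 2 * exceedanceCount (fun k => f (ω k)) (r + 2 * S * (j + 1 : ℕ)) n ≤
        6 * δ * n + c * (exceedanceCount (fun k => f (ω k)) (r + 2 * S * j) n -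
          exceedanceCount (fun k => f (ω k)) (r + 2 * S * (j + 1 : ℕ)) n) := by
    refine (eventually_all_finite (finite_Iio m)).2 fun j _ => ?_
    have h := eventually_exceedanceCount_le_window (y := fun k => f (ω k)) (lam := lam₁ / 2)
      (hR₀L j) hS hδ hS₀.le hS₁.le
      (by linarith [min_le_right (ε * lam₁ / 48) (lam₁ / 2)]) (g₀ δ hδ) (g₁ j δ hδ) (gc j δ hδ)
      (g₂ j δ hδ)
    have e1 : L j - S = r + 2 * S * j := by simp [hL]
    have e2 : L j + S = r + 2 * S * (j + 1 : ℕ) := by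
      simp only [hL]
      push_cast
      ring
    rwa [e1, e2] at h
  refine limsup_card_filter_div_lt (y := fun k => f (ω k)) (η := ε / 2)
    (by linarith) ?_
  filter_upwards [hdrift] with n hn
  have h := mul_exceedanceCount_le_of_windows (by positivity) (by positivity) hc0 m hn
  have hδε : δ ≤ ε * lam₁ / 48 := min_le_left _ _
  have hcoef : (m : ℝ) * (6 * δ) + c ≤ lam₁ / 2 * m * (ε / 2) := by
    nlinarith [mul_le_mul_of_nonneg_left hδε hm0.le]
  have hpos : 0 < lam₁ / 2 * m := by positivity
  refine le_of_mul_le_mul_left (h.trans ?_) hpos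
  calc (m * (6 * δ) + c) * n ≤ lam₁ / 2 * m * (ε / 2) * n := by gcongr
    _ = _ := by ring
end

section
/- Let (X_n) be a Markov chain on Ω and K a measurable subset such that the return-time tails are uniformly summable: Σ_n sup_{x∈K} P_x(τ ≥ n) < ∞, where τ is the first return time to K. Let τ₀ = 0 and τ_i the i-th return time to K, Z_i = τ_i − τ_{i−1}. If sup_{x∈K} E_x[Z₁^{ext}] < ε/2, where Z_i^{ext} counts times n ∈ {τ_{i−1},…,τ_i − 1} with f(X_n) > R, then for every x ∈ K, P_x-almost surely, for all large n: Σ_{i=1}^n Z_i^{ext} < ε·Σ_{i=1}^{n−1} Z_i. -/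
open MeasureTheory Set Filter
open scoped ENNReal

/-- The `i`-th return time to `K` along a trajectory (`τ₀ = 0`). -/
noncomputable def retTime {Ω : Type*} (K : Set Ω) : ℕ → (ℕ → Ω) → ℕ
  | 0, _ => 0
  | i + 1, ω => sInf {n : ℕ | retTime K i ω < n ∧ ω n ∈ K}

/-- Time spent above level `R` during the `i`-th excursion (`i ≥ 1`):
`Z_i^{ext} = #{n ∈ [τ_{i−1}, τ_i) : f(X_n) > R}`. -/
noncomputable def extTime {Ω : Type*} (K : Set Ω) (f : Ω → ℝ) (R : ℝ) (i : ℕ)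
    (ω : ℕ → Ω) : ℕ :=
  ((Finset.Ico (retTime K (i - 1) ω) (retTime K i ω)).filter fun n => R < f (ω n)).card

section Paths

variable {Ω : Type*}

/-- The trajectory seen from time `n` on. -/
def shiftPath (n : ℕ) (ω : ℕ → Ω) : ℕ → Ω := fun k => ω (n + k)

/-- Trajectories that start in `K` and return to `K` at least `i` times. -/
def returnSet (K : Set Ω) (i : ℕ) : Set (ℕ → Ω) :=
  {ω | ω 0 ∈ K ∧ ∀ j < i, ∃ m, retTime K j ω < m ∧ ω m ∈ K}

lemma retTime_succ_spec {K : Set Ω} {i : ℕ} {ω : ℕ → Ω}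
    (h : ∃ m, retTime K i ω < m ∧ ω m ∈ K) :
    retTime K i ω < retTime K (i + 1) ω ∧ ω (retTime K (i + 1) ω) ∈ K :=
  Nat.sInf_mem h

lemma retTime_succ_le {K : Set Ω} {i m : ℕ} {ω : ℕ → Ω} (h : retTime K i ω < m)
    (hm : ω m ∈ K) : retTime K (i + 1) ω ≤ m :=
  Nat.sInf_le ⟨h, hm⟩

lemma mem_returnSet_succ {K : Set Ω} {i : ℕ} {ω : ℕ → Ω} :
    ω ∈ returnSet K (i + 1) ↔
      ω ∈ returnSet K i ∧ ∃ m, retTime K i ω < m ∧ ω m ∈ K := by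
  simp only [returnSet, mem_ofPred_eq, Nat.lt_succ_iff_lt_or_eq, or_imp, forall_and,
    forall_eq, and_assoc]

lemma apply_retTime_mem {K : Set Ω} {i : ℕ} {ω : ℕ → Ω} (h : ω ∈ returnSet K i) :
    ω (retTime K i ω) ∈ K := by
  cases i with
  | zero => exact h.1
  | succ i => exact (retTime_succ_spec (mem_returnSet_succ.1 h).2).2

lemma retTime_le_of_mem_returnSet {K : Set Ω} {i j : ℕ} {ω : ℕ → Ω} (h : ω ∈ returnSet K i)
    (hj : j ≤ i) : retTime K j ω ≤ retTime K i ω := by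
  induction i with
  | zero => simp_all
  | succ i ih =>
    rcases hj.eq_or_lt with rfl | hj
    · rfl
    · obtain ⟨h1, h2⟩ := mem_returnSet_succ.1 h
      exact (ih h1 (Nat.lt_succ_iff.1 hj)).trans (retTime_succ_spec h2).1.le

lemma returnSet_anti {K : Set Ω} {i j : ℕ} (hj : j ≤ i) : returnSet K i ⊆ returnSet K j :=
  fun _ h => ⟨h.1, fun l hl => h.2 l (hl.trans_le hj)⟩

lemma returnSet_congr {K : Set Ω} {i : ℕ} {ω ω' : ℕ → Ω} (h : ω ∈ returnSet K i)
    (heq : ∀ k ≤ retTime K i ω, ω k = ω' k) :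
    ω' ∈ returnSet K i ∧ retTime K i ω' = retTime K i ω := by
  induction i with
  | zero => exact ⟨⟨heq 0 le_rfl ▸ h.1, by simp⟩, rfl⟩
  | succ i ih =>
    obtain ⟨h1, h2⟩ := mem_returnSet_succ.1 h
    obtain ⟨h3, h4⟩ := retTime_succ_spec h2
    obtain ⟨h5, h6⟩ := ih h1 fun k hk => heq k (hk.trans h3.le)
    have h7 : ω' (retTime K (i + 1) ω) ∈ K := heq _ le_rfl ▸ h4
    have h8 : ∃ m, retTime K i ω' < m ∧ ω' m ∈ K := ⟨_, h6 ▸ h3, h7⟩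
    refine ⟨mem_returnSet_succ.2 ⟨h5, h8⟩, ?_⟩
    have h9 : retTime K (i + 1) ω' ≤ retTime K (i + 1) ω := retTime_succ_le (h6 ▸ h3) h7
    obtain ⟨h10, h11⟩ := retTime_succ_spec h8
    refine le_antisymm h9 (retTime_succ_le (h6 ▸ h10) ?_)
    rw [heq _ h9]
    exact h11

lemma extTime_congr {K : Set Ω} {f : Ω → ℝ} {R : ℝ} {i j : ℕ} {ω ω' : ℕ → Ω}
    (h : ω ∈ returnSet K i) (hj : j ≤ i) (heq : ∀ k ≤ retTime K i ω, ω k = ω' k) :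
    extTime K f R j ω = extTime K f R j ω' := by
  have key : ∀ l ≤ i, retTime K l ω' = retTime K l ω := fun l hl =>
    (returnSet_congr (returnSet_anti hl h)
      fun k hk => heq k (hk.trans (retTime_le_of_mem_returnSet h hl))).2
  unfold extTime
  rw [key j hj, key (j - 1) (by omega)]
  congr 1
  refine Finset.filter_congr fun n hn => ?_
  rw [heq n ((Finset.mem_Ico.1 hn).2.le.trans (retTime_le_of_mem_returnSet h hj))]

lemma retTime_succ_eq_zero {K : Set Ω} {i : ℕ} {ω : ℕ → Ω}
    (h : ¬ ∃ m, retTime K i ω < m ∧ ω m ∈ K) : retTime K (i + 1) ω = 0 :=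
  Nat.sInf_eq_zero.2 (Or.inr (not_nonempty_iff_eq_empty.1 h))

lemma extTime_succ (K : Set Ω) (f : Ω → ℝ) (R : ℝ) (i : ℕ) (ω : ℕ → Ω) :
    extTime K f R (i + 1) ω = extTime K f R 1 (shiftPath (retTime K i ω) ω) := by
  by_cases h : ∃ m, retTime K i ω < m ∧ ω m ∈ K
  · obtain ⟨h1, h2⟩ := retTime_succ_spec h
    have hz : retTime K (i + 1) ω
        = retTime K i ω + retTime K 1 (shiftPath (retTime K i ω) ω) := by
      have h0 : ∃ m, retTime K 0 (shiftPath (retTime K i ω) ω) < m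
          ∧ shiftPath (retTime K i ω) ω m ∈ K := by
        refine ⟨retTime K (i + 1) ω - retTime K i ω, ?_, ?_⟩
        · simp only [retTime]; simp only [retTime] at h1; omega
        · rw [shiftPath, Nat.add_sub_cancel' h1.le]; exact h2
      obtain ⟨h3, h4⟩ := retTime_succ_spec h0
      apply le_antisymm
      · refine retTime_succ_le ?_ h4
        have : 0 < retTime K (0 + 1) (shiftPath (retTime K i ω) ω) := h3
        simp only [zero_add] at this ⊢
        omega
      · have : retTime K (0 + 1) (shiftPath (retTime K i ω) ω)
            ≤ retTime K (i + 1) ω - retTime K i ω := by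
          apply retTime_succ_le
          · show 0 < _
            omega
          · rw [shiftPath, Nat.add_sub_cancel' h1.le]; exact h2
        simp only [zero_add] at this
        omega
    have hz0 : ∀ ω' : ℕ → Ω, retTime K (1 - 1) ω' = 0 := fun _ => rfl
    unfold extTime
    rw [hz, hz0, Nat.add_sub_cancel]
    refine (Finset.card_bij (fun n _ => retTime K i ω + n) ?_ ?_ ?_).symm
    · intro a ha
      rw [Finset.mem_filter, Finset.mem_Ico] at ha ⊢
      exact ⟨⟨by omega, by omega⟩, ha.2⟩
    · intro a _ b _ hab
      omega
    · intro b hb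
      rw [Finset.mem_filter, Finset.mem_Ico] at hb
      refine ⟨b - retTime K i ω, ?_, by omega⟩
      rw [Finset.mem_filter, Finset.mem_Ico, shiftPath, Nat.add_sub_cancel' hb.1.1]
      exact ⟨⟨by omega, by omega⟩, hb.2⟩
  · have h0 : ¬ ∃ m, retTime K 0 (shiftPath (retTime K i ω) ω) < m
          ∧ shiftPath (retTime K i ω) ω m ∈ K := by
      rintro ⟨m, hm, hm'⟩
      have hm0 : 0 < m := hm
      exact h ⟨retTime K i ω + m, by omega, hm'⟩
    have h1 : retTime K 1 (shiftPath (retTime K i ω) ω) = 0 := retTime_succ_eq_zero h0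
    simp [extTime, h1, retTime_succ_eq_zero h]

lemma notMem_of_lt_extTime_one {K : Set Ω} {f : Ω → ℝ} {R : ℝ} {m k : ℕ} {ω : ℕ → Ω}
    (hm : m ≤ extTime K f R 1 ω) (hk : 1 ≤ k) (hkm : k < m) : ω k ∉ K := by
  intro hkK
  have h1 : retTime K 1 ω ≤ k := retTime_succ_le (i := 0) (show 0 < k by omega) hkK
  have h2 : extTime K f R 1 ω ≤ retTime K 1 ω - retTime K 0 ω :=
    (Finset.card_filter_le _ _).trans (by simp)
  omega

end Paths

section Measurability

variable {Ω : Type*} [MeasurableSpace Ω]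

lemma measurable_shiftPath (n : ℕ) : Measurable (shiftPath n : (ℕ → Ω) → ℕ → Ω) :=
  measurable_pi_lambda _ fun k => measurable_pi_apply (n + k)

lemma measurableSet_lt_retTime {K : Set Ω} (hK : MeasurableSet K) {i : ℕ}
    (h : Measurable (retTime K i)) (m : ℕ) :
    MeasurableSet {ω : ℕ → Ω | retTime K i ω < m ∧ ω m ∈ K} :=
  (h measurableSet_Iio).inter (measurable_pi_apply m hK)

lemma measurable_retTime {K : Set Ω} (hK : MeasurableSet K) (i : ℕ) :
    Measurable (retTime K i) := by
  induction i with
  | zero => exact measurable_const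
  | succ i ih =>
    have hS := measurableSet_lt_retTime hK ih
    refine measurable_of_Iic fun m => ?_
    have : retTime K (i + 1) ⁻¹' Iic m
        = (⋃ k ∈ Iic m, {ω : ℕ → Ω | retTime K i ω < k ∧ ω k ∈ K})
          ∪ ⋂ k, {ω : ℕ → Ω | retTime K i ω < k ∧ ω k ∈ K}ᶜ := by
      ext ω
      simp only [mem_preimage, mem_Iic, mem_union, mem_iUnion, mem_iInter, mem_ofPred_eq,
        mem_compl_iff, exists_prop]
      by_cases h : ∃ k, retTime K i ω < k ∧ ω k ∈ K
      · constructor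
        · exact fun hm => Or.inl ⟨_, hm, retTime_succ_spec h⟩
        · rintro (⟨k, hk, hk'⟩ | h')
          · exact (retTime_succ_le hk'.1 hk'.2).trans hk
          · exact absurd h (not_exists.2 h')
      · simp only [retTime_succ_eq_zero h, Nat.zero_le, true_iff]
        exact Or.inr (not_exists.1 h)
    rw [this]
    exact (MeasurableSet.biUnion (to_countable _) fun k _ => hS k).union
      (MeasurableSet.iInter fun k => (hS k).compl)

lemma measurableSet_returnSet {K : Set Ω} (hK : MeasurableSet K) (i : ℕ) :
    MeasurableSet (returnSet K i) := by
  have : returnSet K i = {ω : ℕ → Ω | ω 0 ∈ K}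
      ∩ ⋂ j ∈ Iio i, ⋃ m, {ω : ℕ → Ω | retTime K j ω < m ∧ ω m ∈ K} := by
    ext ω
    simp [returnSet]
  rw [this]
  exact (measurable_pi_apply 0 hK).inter (MeasurableSet.biInter (to_countable _) fun j _ =>
    MeasurableSet.iUnion fun m => measurableSet_lt_retTime hK (measurable_retTime hK j) m)

lemma measurable_extTime {K : Set Ω} (hK : MeasurableSet K) {f : Ω → ℝ} (hf : Measurable f)
    (R : ℝ) (i : ℕ) : Measurable (extTime K f R i) := by
  have h : Measurable fun p : (ℕ × ℕ) × (ℕ → Ω) =>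
      ((Finset.Ico p.1.1 p.1.2).filter fun n => R < f (p.2 n)).card := by
    refine measurable_from_prod_countable_right fun p => ?_
    simp only [Finset.card_filter]
    refine Finset.measurable_fun_sum _ fun n _ => ?_
    exact Measurable.ite (measurableSet_lt measurable_const (hf.comp (measurable_pi_apply n)))
      measurable_const measurable_const
  exact h.comp (((measurable_retTime hK _).prodMk (measurable_retTime hK _)).prodMk measurable_id)

end Measurability

section Markov

variable {Ω : Type*} [MeasurableSpace Ω] {P : Ω → Measure (ℕ → Ω)}

/-- The Markov property at a deterministic time, for nonnegative functionals of the future. It is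
an inequality between lower integrals, since `x ↦ P x` need not be measurable. -/
lemma IsMarkovChainFamily.setLIntegral_shiftPath_le (hP : IsMarkovChainFamily P) (x : Ω) (n : ℕ)
    {C : Set (ℕ → Ω)} (hC : MeasurableSet C)
    (hCn : ∀ ω ω' : ℕ → Ω, (∀ k ≤ n, ω k = ω' k) → (ω ∈ C ↔ ω' ∈ C))
    {g : (ℕ → Ω) → ℝ≥0∞} (hg : Measurable g) :
    ∫⁻ ω in C, g (shiftPath n ω) ∂ P x ≤ ∫⁻ ω in C, ∫⁻ ω', g ω' ∂ P (ω n) ∂ P x := by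
  refine Measurable.ennreal_induction (motive := fun g : (ℕ → Ω) → ℝ≥0∞ =>
    ∫⁻ ω in C, g (shiftPath n ω) ∂ P x ≤ ∫⁻ ω in C, ∫⁻ ω', g ω' ∂ P (ω n) ∂ P x) ?_ ?_ ?_ hg
  · intro c B hB
    have h1 : (fun ω => B.indicator (fun _ => c) (shiftPath n ω))
        = (shiftPath n ⁻¹' B).indicator fun _ => c := rfl
    rw [h1, lintegral_indicator_const (measurable_shiftPath n hB),
      Measure.restrict_apply (measurable_shiftPath n hB), inter_comm]
    have h2 := hP.2.2 x n B hB C hC hCn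
    change P x (C ∩ shiftPath n ⁻¹' B) = _ at h2
    rw [h2]
    simp only [lintegral_indicator_const hB]
    exact lintegral_const_mul_le _ _
  · intro u v _ hu hv hu' hv'
    simp only [Pi.add_apply]
    have hu'' : Measurable fun ω => u (shiftPath n ω) := hu.comp (measurable_shiftPath n)
    rw [lintegral_add_left hu'']
    refine (add_le_add hu' hv').trans ((le_lintegral_add _ _).trans (lintegral_mono fun ω => ?_))
    rw [lintegral_add_left hu]
  · intro u hu hmono hle
    have hu' : ∀ m, Measurable fun ω => u m (shiftPath n ω) :=
      fun m => (hu m).comp (measurable_shiftPath n)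
    change ∫⁻ ω in C, ⨆ m, u m (shiftPath n ω) ∂ P x ≤ _
    rw [lintegral_iSup hu' fun _ _ h ω => hmono h _]
    refine iSup_le fun m => (hle m).trans (lintegral_mono fun ω => lintegral_mono fun ω' => ?_)
    exact le_iSup (fun m => u m ω') m

/-- The strong Markov property at the `i`-th return time, as an upper bound. -/
lemma IsMarkovChainFamily.setLIntegral_shiftPath_retTime_le (hP : IsMarkovChainFamily P)
    {K : Set Ω} (hK : MeasurableSet K) {g : (ℕ → Ω) → ℝ≥0∞} (hg : Measurable g) {c : ℝ≥0∞}
    (hc : ∀ y ∈ K, ∫⁻ ω, g ω ∂ P y ≤ c) (x : Ω) (i : ℕ) {V : (ℕ → Ω) → ℕ} (hV : Measurable V)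
    (hVi : ∀ ω ω' : ℕ → Ω, ω ∈ returnSet K i → (∀ k ≤ retTime K i ω, ω k = ω' k) → V ω = V ω')
    (w : ℕ → ℝ≥0∞) :
    ∫⁻ ω in returnSet K i, w (V ω) * g (shiftPath (retTime K i ω) ω) ∂ P x
      ≤ c * ∫⁻ ω in returnSet K i, w (V ω) ∂ P x := by
  set C : ℕ × ℕ → Set (ℕ → Ω) := fun p =>
    returnSet K i ∩ (fun ω => (retTime K i ω, V ω)) ⁻¹' {p} with hCdef
  have hmeas : Measurable fun ω : ℕ → Ω => (retTime K i ω, V ω) :=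
    (measurable_retTime hK i).prodMk hV
  have hCm : ∀ p, MeasurableSet (C p) := fun p =>
    (measurableSet_returnSet hK i).inter (hmeas (measurableSet_singleton p))
  have hCd : Pairwise fun p q => Disjoint (C p) (C q) := by
    intro p q hpq
    refine Set.disjoint_left.2 fun ω hp hq => hpq ?_
    exact hp.2.symm.trans hq.2
  have hCU : returnSet K i = ⋃ p, C p := by
    rw [hCdef, ← inter_iUnion]
    exact (inter_eq_left.2 fun ω _ => mem_iUnion.2 ⟨(retTime K i ω, V ω), rfl⟩).symm
  have hCmem : ∀ p ω, ω ∈ C p → ω ∈ returnSet K i ∧ retTime K i ω = p.1 ∧ V ω = p.2 := by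
    rintro p ω ⟨h1, h2⟩
    simp only [mem_preimage, mem_singleton_iff] at h2
    exact ⟨h1, by rw [← h2], by rw [← h2]⟩
  have hCn1 : ∀ p, ∀ ω ω' : ℕ → Ω, (∀ k ≤ p.1, ω k = ω' k) → ω ∈ C p → ω' ∈ C p := by
    intro p ω ω' heq h
    obtain ⟨h1, h2, h3⟩ := hCmem p ω h
    obtain ⟨h4, h5⟩ := returnSet_congr h1 (h2 ▸ heq)
    refine ⟨h4, ?_⟩
    simp only [mem_preimage, mem_singleton_iff]
    rw [h5, ← hVi ω ω' h1 (h2 ▸ heq), h2, h3]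
  have hCn : ∀ p, ∀ ω ω' : ℕ → Ω, (∀ k ≤ p.1, ω k = ω' k) → (ω ∈ C p ↔ ω' ∈ C p) :=
    fun p ω ω' heq => ⟨hCn1 p ω ω' heq, hCn1 p ω' ω fun k hk => (heq k hk).symm⟩
  rw [hCU, lintegral_iUnion hCm hCd, lintegral_iUnion hCm hCd, ← ENNReal.tsum_mul_left]
  refine ENNReal.tsum_le_tsum fun p => ?_
  calc ∫⁻ ω in C p, w (V ω) * g (shiftPath (retTime K i ω) ω) ∂ P x
      = ∫⁻ ω in C p, w p.2 * g (shiftPath p.1 ω) ∂ P x := by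
        refine setLIntegral_congr_fun (hCm p) fun ω hω => ?_
        obtain ⟨_, h2, h3⟩ := hCmem p ω hω
        simp only [h2, h3]
    _ = w p.2 * ∫⁻ ω in C p, g (shiftPath p.1 ω) ∂ P x :=
        lintegral_const_mul _ (hg.comp (measurable_shiftPath p.1))
    _ ≤ w p.2 * ∫⁻ ω in C p, c ∂ P x := by
        gcongr w p.2 * ?_
        refine (hP.setLIntegral_shiftPath_le x p.1 (hCm p) (hCn p) hg).trans ?_
        refine setLIntegral_mono measurable_const fun ω hω => hc _ ?_
        obtain ⟨h1, h2, _⟩ := hCmem p ω hω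
        exact h2 ▸ apply_retTime_mem h1
    _ = c * ∫⁻ ω in C p, w p.2 ∂ P x := by
        simp only [setLIntegral_const]
        ring
    _ = c * ∫⁻ ω in C p, w (V ω) ∂ P x := by
        congr 1
        refine setLIntegral_congr_fun (hCm p) fun ω hω => ?_
        simp only [(hCmem p ω hω).2.2]

lemma IsMarkovChainFamily.ae_mem_returnSet (hP : IsMarkovChainFamily P)
    {K : Set Ω} (hK : MeasurableSet K)
    (hret : ∀ y ∈ K, P y {ω | ∀ k, 1 ≤ k → ω k ∉ K} = 0) {x : Ω} (hx : x ∈ K) (i : ℕ) :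
    ∀ᵐ ω ∂ P x, ω ∈ returnSet K i := by
  induction i with
  | zero =>
    have := hP.1 x
    have h0 : MeasurableSet {ω : ℕ → Ω | ω 0 ∈ K} := measurable_pi_apply 0 hK
    have h1 : P x {ω : ℕ → Ω | ω 0 ∈ K} = 1 := by
      refine le_antisymm prob_le_one ?_
      rw [← hP.2.1 x]
      refine measure_mono fun ω hω => ?_
      have h2 : ω 0 = x := hω
      change ω 0 ∈ K
      rwa [h2]
    have h2 : ∀ᵐ ω ∂ P x, ω ∈ {ω : ℕ → Ω | ω 0 ∈ K} := (prob_compl_eq_zero_iff h0).2 h1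
    filter_upwards [h2] with ω hω using ⟨hω, by simp⟩
  | succ i ih =>
    set N : Set (ℕ → Ω) := {ω | ∀ k, 1 ≤ k → ω k ∉ K} with hN
    have hNm : MeasurableSet N := by
      have : N = ⋂ k ∈ Ici 1, {ω : ℕ → Ω | ω k ∈ K}ᶜ := by
        ext ω
        simp [hN]
      rw [this]
      exact MeasurableSet.biInter (to_countable _) fun k _ => (measurable_pi_apply k hK).compl
    have hg : Measurable (N.indicator fun _ => (1 : ℝ≥0∞)) := measurable_const.indicator hNm
    have hc : ∀ y ∈ K, ∫⁻ ω, N.indicator (fun _ => (1 : ℝ≥0∞)) ω ∂ P y ≤ 0 := fun y hy => by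
      rw [lintegral_indicator_const hNm, hret y hy, mul_zero]
    have h := hP.setLIntegral_shiftPath_retTime_le hK hg hc x i (V := fun _ => 0)
      measurable_const (fun _ _ _ _ => rfl) fun _ => 1
    have hs : Measurable fun ω : ℕ → Ω => shiftPath (retTime K i ω) ω := by
      refine measurable_pi_lambda _ fun k => ?_
      have : Measurable fun p : ℕ × (ℕ → Ω) => p.2 (p.1 + k) :=
        measurable_from_prod_countable_right fun n => measurable_pi_apply (n + k)
      exact this.comp ((measurable_retTime hK i).prodMk measurable_id)
    simp only [one_mul, zero_mul, nonpos_iff_eq_zero] at h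
    replace h := (lintegral_eq_zero_iff (hg.comp hs)).1 h
    rw [Filter.EventuallyEq, ae_restrict_iff' (measurableSet_returnSet hK i)] at h
    filter_upwards [ih, h] with ω h1 h2
    refine mem_returnSet_succ.2 ⟨h1, ?_⟩
    by_contra hcon
    have h3 : shiftPath (retTime K i ω) ω ∈ N := fun k hk hkK =>
      hcon ⟨retTime K i ω + k, by omega, hkK⟩
    simpa [h3] using h2 h1

lemma IsMarkovChainFamily.lintegral_mul_extTime_le (hP : IsMarkovChainFamily P)
    {K : Set Ω} (hK : MeasurableSet K) {f : Ω → ℝ} (hf : Measurable f) (R : ℝ)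
    (hret : ∀ y ∈ K, P y {ω | ∀ k, 1 ≤ k → ω k ∉ K} = 0) {x : Ω} (hx : x ∈ K) (i : ℕ)
    {φ : ℕ → ℝ≥0∞} {c : ℝ≥0∞} (hc : ∀ y ∈ K, ∫⁻ ω, φ (extTime K f R 1 ω) ∂ P y ≤ c)
    {V : (ℕ → Ω) → ℕ} (hV : Measurable V)
    (hVi : ∀ ω ω' : ℕ → Ω, ω ∈ returnSet K i → (∀ k ≤ retTime K i ω, ω k = ω' k) → V ω = V ω')
    (w : ℕ → ℝ≥0∞) :
    ∫⁻ ω, w (V ω) * φ (extTime K f R (i + 1) ω) ∂ P x ≤ c * ∫⁻ ω, w (V ω) ∂ P x := by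
  have hg : Measurable fun ω => φ (extTime K f R 1 ω) :=
    (measurable_from_nat (f := φ)).comp (measurable_extTime hK hf R 1)
  have h := hP.setLIntegral_shiftPath_retTime_le hK hg hc x i hV hVi w
  rw [Measure.restrict_eq_self_of_ae_mem (hP.ae_mem_returnSet hK hret hx i)] at h
  simpa only [← extTime_succ] using h

end Markov

section Moments

variable {Ω : Type*}

/-- The sum of the first `i` excursion counts, each truncated at `k`. -/
noncomputable def truncSum (K : Set Ω) (f : Ω → ℝ) (R : ℝ) (k i : ℕ) (ω : ℕ → Ω) : ℕ :=
  ∑ j ∈ Finset.range i, min (extTime K f R (j + 1) ω) k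

lemma truncSum_le (K : Set Ω) (f : Ω → ℝ) (R : ℝ) (k i : ℕ) (ω : ℕ → Ω) :
    truncSum K f R k i ω ≤ i * k :=
  (Finset.sum_le_card_nsmul _ _ k fun _ _ => min_le_right _ _).trans (by simp)

lemma truncSum_congr {K : Set Ω} {f : Ω → ℝ} {R : ℝ} {k i : ℕ} {ω ω' : ℕ → Ω}
    (h : ω ∈ returnSet K i) (heq : ∀ k ≤ retTime K i ω, ω k = ω' k) :
    truncSum K f R k i ω = truncSum K f R k i ω' :=
  Finset.sum_congr rfl fun j hj => by
    rw [extTime_congr h (Finset.mem_range.1 hj) heq]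

lemma sq_pos_part_add_le {μ s y : ℝ} (hμ : 0 ≤ μ) (hy : 0 ≤ y) :
    max (s + y - μ) 0 ^ 2 + 2 * (μ * max s 0)
      ≤ max s 0 ^ 2 + 2 * (max s 0 * y) + (y ^ 2 + μ ^ 2) := by
  rcases le_total s 0 with hs | hs
  · rw [max_eq_right hs]
    rcases le_total (s + y - μ) 0 with h | h
    · rw [max_eq_right h]; nlinarith [sq_nonneg y, sq_nonneg μ]
    · rw [max_eq_left h]; nlinarith [sq_nonneg μ]
  · rw [max_eq_left hs]
    rcases le_total (s + y - μ) 0 with h | h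
    · rw [max_eq_right h]; nlinarith [sq_nonneg (s - μ), sq_nonneg y, mul_nonneg hs hy]
    · rw [max_eq_left h]; nlinarith [mul_nonneg hμ hy]

lemma min_sq_le_sum (z k : ℕ) :
    min z k ^ 2 ≤ ∑ m ∈ Finset.range (k + 1), if m ≤ z then 2 * m else 0 := by
  induction k with
  | zero => simp
  | succ k ih =>
    rw [Finset.sum_range_succ]
    by_cases h : k + 1 ≤ z
    · rw [min_eq_right h, if_pos h]
      rw [min_eq_right (by omega)] at ih
      nlinarith
    · rw [if_neg h, min_eq_left (by omega), add_zero]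
      rwa [min_eq_left (by omega)] at ih

variable [MeasurableSpace Ω] {P : Ω → Measure (ℕ → Ω)}

lemma measurable_truncSum {K : Set Ω} (hK : MeasurableSet K) {f : Ω → ℝ} (hf : Measurable f)
    (R : ℝ) (k i : ℕ) : Measurable (truncSum K f R k i) :=
  Finset.measurable_fun_sum _ fun j _ => (measurable_extTime hK hf R (j + 1)).min measurable_const

lemma IsMarkovChainFamily.lintegral_sq_truncSum_le (hP : IsMarkovChainFamily P)
    {K : Set Ω} (hK : MeasurableSet K) {f : Ω → ℝ} (hf : Measurable f) (R : ℝ)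
    (hret : ∀ y ∈ K, P y {ω | ∀ k, 1 ≤ k → ω k ∉ K} = 0) {x : Ω} (hx : x ∈ K) (k : ℕ)
    {μ : ℝ} (hμ : 0 ≤ μ) {q : ℝ≥0∞}
    (h1 : ∀ y ∈ K, ∫⁻ ω, ((min (extTime K f R 1 ω) k : ℕ) : ℝ≥0∞) ∂ P y ≤ ENNReal.ofReal μ)
    (h2 : ∀ y ∈ K, ∫⁻ ω, ((min (extTime K f R 1 ω) k : ℕ) : ℝ≥0∞) ^ 2 ∂ P y ≤ q) (i : ℕ) :
    ∫⁻ ω, ENNReal.ofReal (max (truncSum K f R k i ω - μ * i) 0 ^ 2) ∂ P x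
      ≤ i * (q + ENNReal.ofReal (μ ^ 2)) := by
  have := hP.1 x
  induction i with
  | zero => simp [truncSum]
  | succ i ih =>
    set T := truncSum K f R k i with hT
    have hTm : Measurable T := measurable_truncSum hK hf R k i
    set u : ℕ → ℝ≥0∞ := fun t => ENNReal.ofReal (max (t - μ * i) 0) with hu
    set Y : (ℕ → Ω) → ℕ := fun ω => min (extTime K f R (i + 1) ω) k with hY
    have hYm : Measurable Y := (measurable_extTime hK hf R (i + 1)).min measurable_const
    have hYe : Measurable fun ω => (Y ω : ℝ≥0∞) := measurable_from_nat.comp hYm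
    have hue : Measurable fun ω => u (T ω) := (measurable_from_nat (f := u)).comp hTm
    have hTe : Measurable fun ω => ENNReal.ofReal (max ((T ω : ℝ) - μ * i) 0 ^ 2) :=
      (measurable_from_nat (f := fun t : ℕ => ENNReal.ofReal (max ((t : ℝ) - μ * i) 0 ^ 2))).comp
        hTm
    have hcross : ∫⁻ ω, u (T ω) * (Y ω : ℝ≥0∞) ∂ P x
        ≤ ENNReal.ofReal μ * ∫⁻ ω, u (T ω) ∂ P x :=
      hP.lintegral_mul_extTime_le hK hf R hret hx i (φ := fun z => ((min z k : ℕ) : ℝ≥0∞)) h1 hTm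
        (fun _ _ h heq => truncSum_congr h heq) u
    have hsq : ∫⁻ ω, (Y ω : ℝ≥0∞) ^ 2 ∂ P x ≤ q := by
      simpa using hP.lintegral_mul_extTime_le hK hf R hret hx i
        (φ := fun z => ((min z k : ℕ) : ℝ≥0∞) ^ 2) h2 hTm
        (fun _ _ h heq => truncSum_congr h heq) fun _ => 1
    have hfin : ENNReal.ofReal μ * ∫⁻ ω, u (T ω) ∂ P x ≠ ⊤ := by
      refine ENNReal.mul_ne_top ENNReal.ofReal_ne_top (ne_top_of_le_ne_top
        (b := ∫⁻ _, ENNReal.ofReal ((i * k : ℕ) : ℝ) ∂ P x)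
        (by simp [ENNReal.mul_eq_top]) (lintegral_mono fun ω => ?_))
      refine ENNReal.ofReal_le_ofReal (max_le ?_ (by positivity))
      have h3 : ((T ω : ℕ) : ℝ) ≤ ((i * k : ℕ) : ℝ) := by
        exact_mod_cast truncSum_le K f R k i ω
      have h4 : 0 ≤ μ * i := by positivity
      linarith
    have hpt : ∀ ω, ENNReal.ofReal (max (truncSum K f R k (i + 1) ω - μ * (i + 1 : ℕ)) 0 ^ 2)
        + 2 * (ENNReal.ofReal μ * u (T ω))
        ≤ ENNReal.ofReal (max ((T ω : ℝ) - μ * i) 0 ^ 2) + 2 * (u (T ω) * Y ω)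
          + ((Y ω : ℝ≥0∞) ^ 2 + ENNReal.ofReal (μ ^ 2)) := by
      intro ω
      have h3 := ENNReal.ofReal_le_ofReal (sq_pos_part_add_le (s := (T ω : ℝ) - μ * i) hμ
        (Nat.cast_nonneg (α := ℝ) (Y ω)))
      have h4 : (truncSum K f R k (i + 1) ω : ℝ) - μ * (i + 1 : ℕ)
          = (T ω : ℝ) - μ * i + Y ω - μ := by
        rw [truncSum, Finset.sum_range_succ, hT, truncSum, hY]
        push_cast
        ring
      have h5 : ENNReal.ofReal 2 = 2 := by simp
      rw [ENNReal.ofReal_add (by positivity) (by positivity),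
        ENNReal.ofReal_add (by positivity) (by positivity),
        ENNReal.ofReal_add (by positivity) (by positivity),
        ENNReal.ofReal_add (by positivity) (by positivity),
        ENNReal.ofReal_mul (by positivity), ENNReal.ofReal_mul hμ,
        ENNReal.ofReal_mul (by positivity), ENNReal.ofReal_mul (by positivity),
        ENNReal.ofReal_pow (Nat.cast_nonneg _), ENNReal.ofReal_natCast, h5] at h3
      rw [h4]
      exact h3
    have hlint := lintegral_mono (μ := P x) hpt
    have huYe : Measurable fun ω => u (T ω) * (Y ω : ℝ≥0∞) := hue.mul hYe
    have hYe2 : Measurable fun ω => (Y ω : ℝ≥0∞) ^ 2 + ENNReal.ofReal (μ ^ 2) :=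
      (hYe.pow_const 2).add measurable_const
    have hTe' : Measurable fun ω =>
        ENNReal.ofReal (max (truncSum K f R k (i + 1) ω - μ * (i + 1 : ℕ)) 0 ^ 2) :=
      (measurable_from_nat (f := fun t : ℕ =>
        ENNReal.ofReal (max ((t : ℝ) - μ * (i + 1 : ℕ)) 0 ^ 2))).comp
        (measurable_truncSum hK hf R k (i + 1))
    rw [lintegral_add_left hTe', lintegral_add_right _ hYe2,
      lintegral_add_left hTe, lintegral_add_left (hYe.pow_const 2),
      lintegral_const_mul _ (hue.const_mul _), lintegral_const_mul _ hue,
      lintegral_const_mul _ huYe, lintegral_const, measure_univ, mul_one] at hlint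
    refine (ENNReal.add_le_add_iff_right (ENNReal.mul_ne_top ENNReal.ofNat_ne_top hfin)).1
      (hlint.trans ?_)
    calc _ ≤ i * (q + ENNReal.ofReal (μ ^ 2)) + 2 * (ENNReal.ofReal μ * ∫⁻ ω, u (T ω) ∂ P x)
          + (q + ENNReal.ofReal (μ ^ 2)) := by gcongr
      _ = _ := by push_cast; ring

/-- Chebyshev's inequality for the truncated sums. -/
lemma IsMarkovChainFamily.measure_le_truncSum_le (hP : IsMarkovChainFamily P)
    {K : Set Ω} (hK : MeasurableSet K) {f : Ω → ℝ} (hf : Measurable f) (R : ℝ)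
    (hret : ∀ y ∈ K, P y {ω | ∀ k, 1 ≤ k → ω k ∉ K} = 0) {x : Ω} (hx : x ∈ K) {k : ℕ}
    (hk : k ≠ 0) {μ δ : ℝ} (hμ : 0 ≤ μ) (hδ : 0 < δ) {q : ℝ≥0∞}
    (h1 : ∀ y ∈ K, ∫⁻ ω, ((min (extTime K f R 1 ω) k : ℕ) : ℝ≥0∞) ∂ P y ≤ ENNReal.ofReal μ)
    (h2 : ∀ y ∈ K, ∫⁻ ω, ((min (extTime K f R 1 ω) k : ℕ) : ℝ≥0∞) ^ 2 ∂ P y ≤ q) :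
    P x {ω | (μ + δ) * k ≤ truncSum K f R k k ω}
      ≤ (ENNReal.ofReal (δ ^ 2))⁻¹ * ((k : ℝ≥0∞)⁻¹ * (q + ENNReal.ofReal (μ ^ 2))) := by
  have hmom := hP.lintegral_sq_truncSum_le hK hf R hret hx k hμ h1 h2 k
  have hm : Measurable fun ω => ENNReal.ofReal (max (truncSum K f R k k ω - μ * k) 0 ^ 2) :=
    (measurable_from_nat (f := fun t : ℕ =>
      ENNReal.ofReal (max ((t : ℝ) - μ * k) 0 ^ 2))).comp (measurable_truncSum hK hf R k k)
  have hche := (mul_meas_ge_le_lintegral (μ := P x) hm (ENNReal.ofReal ((δ * k) ^ 2))).trans hmom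
  have hsub : {ω | (μ + δ) * k ≤ truncSum K f R k k ω} ⊆ {ω | ENNReal.ofReal ((δ * k) ^ 2)
      ≤ ENNReal.ofReal (max (truncSum K f R k k ω - μ * k) 0 ^ 2)} := by
    intro ω hω
    have hω' : (μ + δ) * k ≤ truncSum K f R k k ω := hω
    refine ENNReal.ofReal_le_ofReal (pow_le_pow_left₀ (by positivity) (le_max_of_le_left ?_) 2)
    linarith
  have hd : ENNReal.ofReal (δ ^ 2) ≠ 0 := by
    simp only [ne_eq, ENNReal.ofReal_eq_zero, not_le]; positivity
  have hk0 : (k : ℝ≥0∞) ≠ 0 := by exact_mod_cast hk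
  have hkt : (k : ℝ≥0∞) ≠ ⊤ := ENNReal.natCast_ne_top k
  have hche' := (mul_le_mul_right (measure_mono hsub (μ := P x))
    (ENNReal.ofReal ((δ * k) ^ 2))).trans hche
  rw [mul_pow, ENNReal.ofReal_mul (by positivity), ENNReal.ofReal_pow (Nat.cast_nonneg _),
    ENNReal.ofReal_natCast] at hche'
  calc P x {ω | (μ + δ) * k ≤ truncSum K f R k k ω}
      = (ENNReal.ofReal (δ ^ 2))⁻¹ * ((k : ℝ≥0∞)⁻¹ * ((k : ℝ≥0∞)⁻¹ *
          (ENNReal.ofReal (δ ^ 2) * (k : ℝ≥0∞) ^ 2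
            * P x {ω | (μ + δ) * k ≤ truncSum K f R k k ω}))) := by
        set A := P x {ω | (μ + δ) * k ≤ truncSum K f R k k ω}
        calc A = ((ENNReal.ofReal (δ ^ 2))⁻¹ * ENNReal.ofReal (δ ^ 2))
              * ((k : ℝ≥0∞)⁻¹ * k) * ((k : ℝ≥0∞)⁻¹ * k) * A := by
              rw [ENNReal.inv_mul_cancel hd ENNReal.ofReal_ne_top,
                ENNReal.inv_mul_cancel hk0 hkt, one_mul, one_mul, one_mul]
          _ = _ := by ring
    _ ≤ (ENNReal.ofReal (δ ^ 2))⁻¹ * ((k : ℝ≥0∞)⁻¹ * ((k : ℝ≥0∞)⁻¹ *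
          (k * (q + ENNReal.ofReal (μ ^ 2))))) := by gcongr
    _ = _ := by
        rw [← mul_assoc (k : ℝ≥0∞)⁻¹ (k : ℝ≥0∞), ENNReal.inv_mul_cancel hk0 hkt, one_mul]

lemma tsum_inv_two_pow_le (c m : ℕ) :
    ∑' j : ℕ, (if m ≤ c * 2 ^ j then ((c * 2 ^ j : ℕ) : ℝ≥0∞)⁻¹ else 0)
      ≤ 2 * (m : ℝ≥0∞)⁻¹ := by
  refine ENNReal.tsum_le_of_sum_range_le fun N => ?_
  suffices h : ∑ j ∈ Finset.range N, (if m ≤ c * 2 ^ j then ((c * 2 ^ j : ℕ) : ℝ≥0∞)⁻¹ else 0)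
      + 2 * ((max m (c * 2 ^ N) : ℕ) : ℝ≥0∞)⁻¹ ≤ 2 * (m : ℝ≥0∞)⁻¹ from le_self_add.trans h
  induction N with
  | zero =>
    simp only [Finset.range_zero, Finset.sum_empty, zero_add]
    gcongr
    exact le_max_left _ _
  | succ N ih =>
    refine le_trans ?_ ih
    rw [Finset.sum_range_succ, add_assoc]
    gcongr
    by_cases h : m ≤ c * 2 ^ N
    · have h' : m ≤ c * 2 ^ (N + 1) := h.trans (by gcongr <;> omega)
      rw [if_pos h, max_eq_right h, max_eq_right h', pow_succ, ← mul_assoc,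
        Nat.cast_mul (c * 2 ^ N) 2, ENNReal.mul_inv (by right; simp) (by right; simp),
        mul_comm _ ((2 : ℕ) : ℝ≥0∞)⁻¹, ← mul_assoc, Nat.cast_ofNat,
        ENNReal.mul_inv_cancel (by simp) (by simp), one_mul, two_mul]
    · rw [if_neg h, zero_add]
      gcongr <;> omega

end Moments

section StrongLaw

variable {Ω : Type*} [MeasurableSpace Ω] {P : Ω → Measure (ℕ → Ω)}

/-- The worst-case tail `sup_{x∈K} P_x(τ ≥ n)` of the return time to `K`. -/
noncomputable def returnTail (P : Ω → Measure (ℕ → Ω)) (K : Set Ω) (n : ℕ) : ℝ≥0∞ :=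
  ⨆ x ∈ K, P x {ω | ∀ k, 1 ≤ k → k < n → ω k ∉ K}

lemma measure_le_returnTail {K : Set Ω} {y : Ω} (hy : y ∈ K) (n : ℕ) :
    P y {ω | ∀ k, 1 ≤ k → k < n → ω k ∉ K} ≤ returnTail P K n :=
  le_iSup₂ (f := fun x (_ : x ∈ K) => P x {ω | ∀ k, 1 ≤ k → k < n → ω k ∉ K}) y hy

lemma measure_no_return_eq_zero {K : Set Ω} (hsum : ∑' n, returnTail P K n ≠ ⊤) {y : Ω}
    (hy : y ∈ K) : P y {ω | ∀ k, 1 ≤ k → ω k ∉ K} = 0 := by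
  refine le_antisymm (ge_of_tendsto' (ENNReal.tendsto_atTop_zero_of_tsum_ne_top hsum)
    fun n => ?_) zero_le
  refine le_trans (measure_mono ?_) (measure_le_returnTail hy n)
  exact fun ω hω k hk _ => hω k hk

lemma measure_le_extTime_one_le {K : Set Ω} (f : Ω → ℝ) (R : ℝ) {y : Ω} (hy : y ∈ K) (m : ℕ) :
    P y {ω | m ≤ extTime K f R 1 ω} ≤ returnTail P K m := by
  refine le_trans (measure_mono ?_) (measure_le_returnTail hy m)
  exact fun ω hω k hk hkm => notMem_of_lt_extTime_one hω hk hkm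

lemma lintegral_sq_min_extTime_le {K : Set Ω} (hK : MeasurableSet K) {f : Ω → ℝ}
    (hf : Measurable f) (R : ℝ) {y : Ω} (hy : y ∈ K) (k : ℕ) :
    ∫⁻ ω, ((min (extTime K f R 1 ω) k : ℕ) : ℝ≥0∞) ^ 2 ∂ P y
      ≤ ∑ m ∈ Finset.range (k + 1), 2 * m * returnTail P K m := by
  have hS : ∀ m, MeasurableSet {ω | m ≤ extTime K f R 1 ω} := fun m =>
    measurable_extTime hK hf R 1 measurableSet_Ici
  calc ∫⁻ ω, ((min (extTime K f R 1 ω) k : ℕ) : ℝ≥0∞) ^ 2 ∂ P y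
      ≤ ∫⁻ ω, ∑ m ∈ Finset.range (k + 1),
          {ω | m ≤ extTime K f R 1 ω}.indicator (fun _ => (2 * m : ℝ≥0∞)) ω ∂ P y := by
        refine lintegral_mono fun ω => ?_
        have h := (Nat.cast_le (α := ℝ≥0∞)).2 (min_sq_le_sum (extTime K f R 1 ω) k)
        push_cast at h
        simpa only [indicator_apply, mem_ofPred_eq, Nat.cast_min] using h
    _ = ∑ m ∈ Finset.range (k + 1), 2 * m * P y {ω | m ≤ extTime K f R 1 ω} := by
        rw [lintegral_finsetSum _ fun m _ => measurable_const.indicator (hS m)]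
        exact Finset.sum_congr rfl fun m _ => lintegral_indicator_const (hS m) _
    _ ≤ _ := by
        gcongr with m _
        exact measure_le_extTime_one_le f R hy m

lemma tsum_inv_mul_sum_returnTail_ne_top {K : Set Ω} (hsum : ∑' n, returnTail P K n ≠ ⊤)
    (c : ℕ) :
    ∑' j : ℕ, ((c * 2 ^ j : ℕ) : ℝ≥0∞)⁻¹
      * ∑ m ∈ Finset.range (c * 2 ^ j + 1), 2 * m * returnTail P K m ≠ ⊤ := by
  have h1 : ∀ k : ℕ, (k : ℝ≥0∞)⁻¹ * ∑ m ∈ Finset.range (k + 1), 2 * m * returnTail P K m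
      = ∑' m : ℕ, 2 * m * returnTail P K m * if m ≤ k then (k : ℝ≥0∞)⁻¹ else 0 := by
    intro k
    rw [tsum_eq_sum (s := Finset.range (k + 1)), Finset.mul_sum]
    · refine Finset.sum_congr rfl fun m hm => ?_
      rw [if_pos (Nat.lt_succ_iff.1 (Finset.mem_range.1 hm)), mul_comm]
    · intro m hm
      rw [if_neg (by simpa using hm), mul_zero]
  simp only [h1]
  rw [ENNReal.tsum_comm]
  refine ne_top_of_le_ne_top (b := ∑' m, 4 * returnTail P K m) ?_
    (ENNReal.tsum_le_tsum fun m => ?_)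
  · rw [ENNReal.tsum_mul_left]
    exact ENNReal.mul_ne_top (by simp) hsum
  · rw [ENNReal.tsum_mul_left]
    calc _ ≤ 2 * m * returnTail P K m * (2 * (m : ℝ≥0∞)⁻¹) := by
          gcongr
          exact tsum_inv_two_pow_le c m
      _ = 4 * (m * (m : ℝ≥0∞)⁻¹) * returnTail P K m := by ring
      _ ≤ 4 * 1 * returnTail P K m := by
          gcongr
          exact ENNReal.mul_inv_le_one _
      _ = _ := by ring

/-- Along a geometric sequence of times, the truncated sums almost surely obey the law of large
numbers as an upper bound. -/
lemma IsMarkovChainFamily.ae_eventually_truncSum_lt (hP : IsMarkovChainFamily P)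
    {K : Set Ω} (hK : MeasurableSet K) {f : Ω → ℝ} (hf : Measurable f) (R : ℝ)
    (hsum : ∑' n, returnTail P K n ≠ ⊤) {x : Ω} (hx : x ∈ K) {μ δ : ℝ} (hμ : 0 ≤ μ) (hδ : 0 < δ)
    (hext : ∀ y ∈ K, ∫⁻ ω, (extTime K f R 1 ω : ℝ≥0∞) ∂ P y ≤ ENNReal.ofReal μ)
    {c : ℕ} (hc : c ≠ 0) :
    ∀ᵐ ω ∂ P x, ∀ᶠ j in atTop,
      (truncSum K f R (c * 2 ^ j) (c * 2 ^ j) ω : ℝ) < (μ + δ) * (c * 2 ^ j : ℕ) := by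
  have h : ∑' j, P x {ω | (μ + δ) * (c * 2 ^ j : ℕ)
      ≤ truncSum K f R (c * 2 ^ j) (c * 2 ^ j) ω} ≠ ⊤ := by
    refine ne_top_of_le_ne_top ?_ (ENNReal.tsum_le_tsum fun j =>
      hP.measure_le_truncSum_le hK hf R (fun y hy => measure_no_return_eq_zero hsum hy) hx
        (k := c * 2 ^ j) (by positivity) hμ hδ
        (fun y hy => (lintegral_mono fun ω => ?_).trans (hext y hy))
        (fun y hy => lintegral_sq_min_extTime_le hK hf R hy (c * 2 ^ j)))
    · rw [ENNReal.tsum_mul_left]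
      refine ENNReal.mul_ne_top (ENNReal.inv_ne_top.2 ?_) ?_
      · simp only [ne_eq, ENNReal.ofReal_eq_zero, not_le]; positivity
      simp only [mul_add]
      rw [ENNReal.tsum_add, ENNReal.tsum_mul_right]
      refine ENNReal.add_ne_top.2 ⟨tsum_inv_mul_sum_returnTail_ne_top hsum c,
        ENNReal.mul_ne_top ?_ ENNReal.ofReal_ne_top⟩
      refine ne_top_of_le_ne_top ?_ ((ENNReal.tsum_le_tsum fun j => ?_).trans
        (tsum_inv_two_pow_le c 1))
      · simp
      · rw [if_pos (Nat.one_le_iff_ne_zero.2 (by positivity))]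
    · exact Nat.cast_le.2 (min_le_left _ _)
  filter_upwards [ae_eventually_notMem h] with ω hω
  filter_upwards [hω] with j hj
  exact not_le.1 hj

lemma IsMarkovChainFamily.ae_eventually_extTime_lt (hP : IsMarkovChainFamily P)
    {K : Set Ω} (hK : MeasurableSet K) {f : Ω → ℝ} (hf : Measurable f) (R : ℝ)
    (hsum : ∑' n, returnTail P K n ≠ ⊤) {x : Ω} (hx : x ∈ K) :
    ∀ᵐ ω ∂ P x, ∀ᶠ i in atTop, extTime K f R (i + 1) ω < i := by
  have hb : ∀ i, P x {ω | i ≤ extTime K f R (i + 1) ω} ≤ returnTail P K i := by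
    intro i
    have := hP.1 x
    have hS : ∀ l, MeasurableSet {ω | i ≤ extTime K f R l ω} := fun l =>
      measurable_extTime hK hf R l measurableSet_Ici
    have hind : ∀ l, (fun ω => if i ≤ extTime K f R l ω then (1 : ℝ≥0∞) else 0)
        = {ω | i ≤ extTime K f R l ω}.indicator fun _ => 1 := by
      intro l
      ext ω
      simp [indicator_apply]
    have h := hP.lintegral_mul_extTime_le hK hf R
      (fun y hy => measure_no_return_eq_zero hsum hy) hx i
      (φ := fun z => if i ≤ z then 1 else 0) (c := returnTail P K i) (fun y hy => by
        rw [hind, lintegral_indicator_const (hS 1), one_mul]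
        exact measure_le_extTime_one_le f R hy i)
      (V := fun _ => 0) measurable_const (fun _ _ _ _ => rfl) fun _ => 1
    simp only [one_mul] at h
    rwa [hind, lintegral_indicator_const (hS (i + 1)), one_mul, lintegral_one, measure_univ,
      mul_one] at h
  filter_upwards [ae_eventually_notMem (ne_top_of_le_ne_top hsum (ENNReal.tsum_le_tsum hb))]
    with ω hω
  filter_upwards [hω] with i hi
  exact not_le.1 hi

end StrongLaw

lemma eventually_truncated_sum_eq {z : ℕ → ℕ} (hz : ∀ᶠ i in atTop, z i < i) :
    ∀ᶠ k in atTop, ∑ i ∈ Finset.range k, min (z i) k = ∑ i ∈ Finset.range k, z i := by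
  obtain ⟨N, hN⟩ := eventually_atTop.1 hz
  filter_upwards [eventually_ge_atTop (∑ i ∈ Finset.range N, z i)] with k hk
  refine Finset.sum_congr rfl fun i hi => min_eq_left ?_
  rcases lt_or_ge i N with h | h
  · exact (Finset.single_le_sum (f := z) (fun _ _ => Nat.zero_le _)
      (Finset.mem_range.2 h)).trans hk
  · exact ((hN i h).trans (Finset.mem_range.1 hi)).le

/-- Interpolation between the times `2 * 2 ^ j` and `3 * 2 ^ j`. -/
lemma eventually_lt_of_eventually_two_pow {S : ℕ → ℝ} (hS : Monotone S) {ε : ℝ} (hε : 0 < ε)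
    (h2 : ∀ᶠ j in atTop, S (2 * 2 ^ j) < (ε / 2 + ε / 12) * (2 * 2 ^ j : ℕ))
    (h3 : ∀ᶠ j in atTop, S (3 * 2 ^ j) < (ε / 2 + ε / 12) * (3 * 2 ^ j : ℕ)) :
    ∀ᶠ n : ℕ in atTop, S n < ε * (n - 1 : ℕ) := by
  obtain ⟨J, hJ⟩ := eventually_atTop.1 (h2.and h3)
  filter_upwards [eventually_ge_atTop (2 * 2 ^ J), eventually_ge_atTop 9] with n hn hn9
  set l := Nat.log 2 n with hl
  have hn0 : n ≠ 0 := by omega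
  have hl1 : 2 ^ l ≤ n := Nat.pow_log_le_self 2 hn0
  have hl2 : n < 2 ^ (l + 1) := Nat.lt_pow_succ_log_self (by norm_num) n
  have hJl : J + 1 ≤ l := Nat.le_log_of_pow_le (by norm_num) (by rw [pow_succ]; omega)
  obtain ⟨j, hj⟩ : ∃ j, l = j + 1 := ⟨l - 1, by omega⟩
  rw [hj, pow_succ] at hl1
  rw [hj, pow_succ, pow_succ] at hl2
  have hcast : ((n - 1 : ℕ) : ℝ) = n - 1 := by rw [Nat.cast_sub (by omega)]; simp
  rw [hcast]
  have hl1' : ((2 ^ j * 2 : ℕ) : ℝ) ≤ n := by exact_mod_cast hl1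
  have hn9' : (9 : ℝ) ≤ n := by exact_mod_cast hn9
  push_cast at hl1'
  rcases le_or_gt n (3 * 2 ^ j) with h | h
  · have h4 := (hJ j (by omega)).2
    have h5 := hS h
    push_cast at h4
    nlinarith [mul_le_mul_of_nonneg_left hl1' hε.le, mul_le_mul_of_nonneg_left hn9' hε.le]
  · have h4 := (hJ (j + 1) (by omega)).1
    have h5 : S n ≤ S (2 * 2 ^ (j + 1)) := hS (by rw [pow_succ]; omega)
    have h6 : ((3 * 2 ^ j : ℕ) : ℝ) ≤ n := by exact_mod_cast h.le
    rw [pow_succ] at h4 h5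
    push_cast at h4 h6
    nlinarith [mul_le_mul_of_nonneg_left h6 hε.le, mul_le_mul_of_nonneg_left hn9' hε.le]

/-- If the return-time tails to `K` are uniformly summable and
`sup_{x∈K} E_x[Z₁^{ext}] < ε/2`, then for every `x ∈ K`, almost surely, for all large `n`,
`Σ_{i=1}^n Z_i^{ext} < ε Σ_{i=1}^{n−1} Z_i`. -/
theorem stmt13 {Ω : Type*} [MeasurableSpace Ω] (P : Ω → Measure (ℕ → Ω))
    (hP : IsMarkovChainFamily P)
    (f : Ω → ℝ) (hf : Measurable f) (hf0 : ∀ x, 0 ≤ f x)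
    (K : Set Ω) (hK : MeasurableSet K) (R ε : ℝ) (hε : 0 < ε)
    (hsum : (∑' n : ℕ, ⨆ x ∈ K, P x {ω | ∀ k, 1 ≤ k → k < n → ω k ∉ K}) < ⊤)
    (hext : ∀ x ∈ K, ∫⁻ ω, (extTime K f R 1 ω : ℝ≥0∞) ∂ P x < ENNReal.ofReal (ε / 2)) :
    ∀ x ∈ K, ∀ᵐ ω ∂ P x, ∀ᶠ n in Filter.atTop,
      (∑ i ∈ Finset.Icc 1 n, (extTime K f R i ω : ℝ))
        < ε * ∑ i ∈ Finset.Icc 1 (n - 1),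
            ((retTime K i ω - retTime K (i - 1) ω : ℕ) : ℝ) := by
  intro x hx
  have hs : ∑' n, returnTail P K n ≠ ⊤ := hsum.ne
  have hret : ∀ y ∈ K, P y {ω | ∀ k, 1 ≤ k → ω k ∉ K} = 0 :=
    fun y hy => measure_no_return_eq_zero hs hy
  have hlaw : ∀ c : ℕ, c ≠ 0 → ∀ᵐ ω ∂ P x, ∀ᶠ j in atTop,
      (truncSum K f R (c * 2 ^ j) (c * 2 ^ j) ω : ℝ) < (ε / 2 + ε / 12) * (c * 2 ^ j : ℕ) :=
    fun c hc => hP.ae_eventually_truncSum_lt hK hf R hs hx (half_pos hε).le (by positivity)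
      (fun y hy => (hext y hy).le) hc
  filter_upwards [hlaw 2 (by norm_num), hlaw 3 (by norm_num),
    hP.ae_eventually_extTime_lt hK hf R hs hx, ae_all_iff.2 (hP.ae_mem_returnSet hK hret hx)]
    with ω h2 h3 hz hG
  set S : ℕ → ℝ := fun n => ∑ i ∈ Finset.Icc 1 n, (extTime K f R i ω : ℝ) with hSdef
  have hSmono : Monotone S := fun a b hab =>
    Finset.sum_le_sum_of_subset_of_nonneg (Finset.Icc_subset_Icc_right hab)
      fun _ _ _ => Nat.cast_nonneg _
  have htrunc := eventually_truncated_sum_eq hz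
  have hSk : ∀ k, S k = ((∑ i ∈ Finset.range k, extTime K f R (i + 1) ω : ℕ) : ℝ) := by
    intro k
    rw [Finset.range_eq_Ico, Finset.sum_Ico_add' (fun i => extTime K f R i ω) 0 k 1]
    push_cast
    rfl
  have hsub : ∀ c : ℕ, c ≠ 0 → ∀ᶠ j in atTop,
      (truncSum K f R (c * 2 ^ j) (c * 2 ^ j) ω : ℝ) = S (c * 2 ^ j) := by
    intro c hc
    have ht : Tendsto (fun j : ℕ => c * 2 ^ j) atTop atTop :=
      (tendsto_pow_atTop_atTop_of_one_lt (by norm_num)).const_mul_atTop' (Nat.pos_of_ne_zero hc)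
    filter_upwards [ht.eventually htrunc] with j hj
    rw [hSk, ← hj, truncSum]
  have hS2 : ∀ᶠ j in atTop, S (2 * 2 ^ j) < (ε / 2 + ε / 12) * (2 * 2 ^ j : ℕ) := by
    filter_upwards [h2, hsub 2 (by norm_num)] with j hj hj'
    rwa [← hj']
  have hS3 : ∀ᶠ j in atTop, S (3 * 2 ^ j) < (ε / 2 + ε / 12) * (3 * 2 ^ j : ℕ) := by
    filter_upwards [h3, hsub 3 (by norm_num)] with j hj hj'
    rwa [← hj']
  filter_upwards [eventually_lt_of_eventually_two_pow hSmono hε hS2 hS3] with n hn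
  refine hn.trans_le (mul_le_mul_of_nonneg_left ?_ hε.le)
  calc ((n - 1 : ℕ) : ℝ) = ∑ i ∈ Finset.Icc 1 (n - 1), (1 : ℝ) := by simp
    _ ≤ _ := by
      refine Finset.sum_le_sum fun i hi => ?_
      obtain ⟨l, rfl⟩ : ∃ l, i = l + 1 := ⟨i - 1, by have := (Finset.mem_Icc.1 hi).1; omega⟩
      have := (retTime_succ_spec (mem_returnSet_succ.1 (hG (l + 1))).2).1
      rw [Nat.add_sub_cancel, Nat.one_le_cast]
      omega
end
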